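/- arXiv:2108.07066 — 2 statements merged into one kernel-verified Lean document; each statement's English description precedes it below -/
import Mathlib

section
/- Let s ≥ 1 be an integer, let G be an H_s-free graph with clique number ω ≥ 200, and let 𝓛 = (L_0, L_1, …, L_k) be an optimal s-template in G whose value is at least 28ω^{s+6}. Then every vertex in N(𝓛) is pendant, dense, or pure with respect to 𝓛. -/
open SimpleGraph Set

/-- `G` contains no induced subgraph isomorphic to `H`. -/
def IsInducedFree {V : Type*} {W : Type*} (G : SimpleGraph V) (H : SimpleGraph W) : Prop :=
  ∀ s : Set V, ¬ Nonempty ((G.induce s) ≃g H)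

/-- The double star `H_s`: two adjacent internal vertices `0` and `1`; `0` is adjacent to the
`s` leaves `2,…,s+1` and `1` is adjacent to the `s` leaves `s+2,…,2s+1`. -/
def doubleStarGraph (s : ℕ) : SimpleGraph (Fin (2*s+2)) :=
  SimpleGraph.fromRel (fun a b =>
    ((a : ℕ) = 0 ∧ (b : ℕ) = 1) ∨
    ((a : ℕ) = 0 ∧ 2 ≤ (b : ℕ) ∧ (b : ℕ) ≤ s+1) ∨
    ((a : ℕ) = 1 ∧ s+2 ≤ (b : ℕ)))

/-- A graph has degeneracy at most `d` if every nonempty subgraph has a vertex whose degree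
in that subgraph is at most `d`. -/
def DegeneracyAtMost {V : Type*} (G : SimpleGraph V) (d : ℕ) : Prop :=
  ∀ H : G.Subgraph, H.verts.Nonempty → ∃ v ∈ H.verts, (H.neighborSet v).ncard ≤ d

/-- A `(k,d)`-colouring: a partition of the vertex set into `k` parts, each inducing a
subgraph of degeneracy at most `d`. -/
def KDColorable {V : Type*} (G : SimpleGraph V) (k d : ℕ) : Prop :=
  ∃ f : V → Fin k, ∀ i : Fin k, DegeneracyAtMost (G.induce {v | f v = i}) d

/-- `G` contains the complete bipartite graph `K_{t,t}` as a (not necessarily induced)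
subgraph. -/
def ContainsKtt {V : Type*} (G : SimpleGraph V) (t : ℕ) : Prop :=
  ∃ A B : Finset V, A.card = t ∧ B.card = t ∧ Disjoint A B ∧
    ∀ a ∈ A, ∀ b ∈ B, G.Adj a b

/-- A set of vertices is stable (independent) if no two of its members are adjacent. -/
def IsStableSet {V : Type*} (G : SimpleGraph V) (S : Set V) : Prop :=
  ∀ a ∈ S, ∀ b ∈ S, a ≠ b → ¬ G.Adj a b

/-- An `s`-template in `G`: a clique `L0` complete to all the `L i`, pairwise disjoint sets
`L 1, …, L k` (here indexed by `Fin k`) whose sizes lie between `ω^{s+5}` and `14 ω^{s+6}`,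
such that each vertex of `L i` has at most `ω^{s+3}` non-neighbours in each other `L j`. -/
def IsTemplate {V : Type*} (G : SimpleGraph V) (s : ℕ) (L0 : Set V) {k : ℕ}
    (L : Fin k → Set V) : Prop :=
  (∀ i : Fin k, Disjoint L0 (L i)) ∧
  (Pairwise fun i j : Fin k => Disjoint (L i) (L j)) ∧
  G.IsClique L0 ∧
  (∀ u ∈ L0, ∀ i : Fin k, ∀ v ∈ L i, G.Adj u v) ∧
  (∀ i : Fin k, G.cliqueNum ^ (s+5) ≤ (L i).ncard ∧ (L i).ncard ≤ 14 * G.cliqueNum ^ (s+6)) ∧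
  (∀ i j : Fin k, i ≠ j → ∀ v ∈ L i,
    ({u ∈ L j | ¬ G.Adj v u}).ncard ≤ G.cliqueNum ^ (s+3))

/-- The value of an `s`-template. -/
noncomputable def templateValue {V : Type*} (G : SimpleGraph V) (s : ℕ) (L0 : Set V) {k : ℕ}
    (L : Fin k → Set V) : ℕ :=
  (⋃ i, L i).ncard + 7 * G.cliqueNum ^ (s+5) * L0.ncard + k * G.cliqueNum ^ (s+5)

/-- An optimal `s`-template: one of maximum value among all `s`-templates in `G`. -/
def IsOptimalTemplate {V : Type*} (G : SimpleGraph V) (s : ℕ) (L0 : Set V) {k : ℕ}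
    (L : Fin k → Set V) : Prop :=
  IsTemplate G s L0 L ∧
  ∀ (k' : ℕ) (L0' : Set V) (L' : Fin k' → Set V), IsTemplate G s L0' L' →
    templateValue G s L0' L' ≤ templateValue G s L0 L

/-- `V(𝓛)`, the vertex set of a template. -/
def templateVerts {V : Type*} (L0 : Set V) {k : ℕ} (L : Fin k → Set V) : Set V :=
  L0 ∪ ⋃ i, L i

/-- `N(𝓛)`: the vertices outside `V(𝓛)` with a neighbour in `L 1 ∪ ⋯ ∪ L k`. -/
def templateNbhd {V : Type*} (G : SimpleGraph V) (L0 : Set V) {k : ℕ}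
    (L : Fin k → Set V) : Set V :=
  {v | v ∉ templateVerts L0 L ∧ ∃ i : Fin k, ∃ u ∈ L i, G.Adj v u}


/-- A vertex `v` is pendant with respect to the template: there are distinct `i, j`, a vertex
`u ∈ L j` and a stable set `S ⊆ L i` of `s+1` common neighbours of `u` such that `v` is not
adjacent to `u` and `v` has exactly one neighbour in `S`. -/
def TemplatePendant {V : Type*} (G : SimpleGraph V) (s : ℕ) {k : ℕ}
    (L : Fin k → Set V) (v : V) : Prop :=
  ∃ i j : Fin k, i ≠ j ∧ ∃ u ∈ L j, ∃ S : Set V, S ⊆ L i ∧ S.ncard = s + 1 ∧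
    IsStableSet G S ∧ (∀ w ∈ S, G.Adj u w) ∧ ¬ G.Adj v u ∧ ({w ∈ S | G.Adj v w}).ncard = 1

/-- A vertex `v` is dense with respect to the template: there are `j` and `u ∈ L j` such that
for all `i ≠ j`, fewer than `ω^{s+2}/14` vertices of `L i` are adjacent to `u` and not to `v`. -/
def TemplateDense {V : Type*} (G : SimpleGraph V) (s : ℕ) {k : ℕ}
    (L : Fin k → Set V) (v : V) : Prop :=
  ∃ j : Fin k, ∃ u ∈ L j, ∀ i : Fin k, i ≠ j →
    14 * ({w ∈ L i | G.Adj u w ∧ ¬ G.Adj v w}).ncard < G.cliqueNum ^ (s+2)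

/-- A vertex `v` is pure with respect to the template: it has no neighbour in at least two of
the sets `L i`, and for each `i`, either it has no neighbour in `L i` or it has at most
`ω^{s+2}/7` non-neighbours in `L i`. -/
def TemplatePure {V : Type*} (G : SimpleGraph V) (s : ℕ) {k : ℕ}
    (L : Fin k → Set V) (v : V) : Prop :=
  (∃ i₁ i₂ : Fin k, i₁ ≠ i₂ ∧ (∀ w ∈ L i₁, ¬ G.Adj v w) ∧ (∀ w ∈ L i₂, ¬ G.Adj v w)) ∧
  (∀ i : Fin k, (∀ w ∈ L i, ¬ G.Adj v w) ∨
    7 * ({w ∈ L i | ¬ G.Adj v w}).ncard ≤ G.cliqueNum ^ (s+2))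

/-- `M_I`: the pure vertices `v` (with respect to the template) whose set `I_v` of indices `i`
such that `v` has a neighbour in `L i` equals `I`. -/
def templatePart {V : Type*} (G : SimpleGraph V) (s : ℕ) (L0 : Set V) {k : ℕ}
    (L : Fin k → Set V) (I : Set (Fin k)) : Set V :=
  {v | v ∈ templateNbhd G L0 L ∧ TemplatePure G s L v ∧
    ∀ i : Fin k, (∃ u ∈ L i, G.Adj v u) ↔ i ∈ I}

/-- Two disjoint sets `A, B` are `s`-crowded if there is no stable set meeting each of them
in exactly `s` vertices. -/
def SCrowded {V : Type*} (G : SimpleGraph V) (s : ℕ) (A B : Set V) : Prop :=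
  ¬ ∃ X : Set V, IsStableSet G X ∧ (X ∩ A).ncard = s ∧ (X ∩ B).ncard = s

/-- `c` satisfies the Kővári–Sós–Turán-type bound for `H_s`: every `H_s`-free graph either
contains `K_{t,t}` as a subgraph or has degeneracy less than `t^c`. -/
def KSTBound (s c : ℕ) : Prop :=
  ∀ (W : Type) [Fintype W], ∀ G' : SimpleGraph W, IsInducedFree G' (doubleStarGraph s) →
    ∀ t : ℕ, ContainsKtt G' t ∨ ∃ D : ℕ, D < t ^ c ∧ DegeneracyAtMost G' D

/-- `Z(𝓛)`: the union of `L0` with the set of vertices of `N(𝓛)` having at most `ω^{s+2}/4`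
non-neighbours in each `L i`. -/
def templateZ {V : Type*} (G : SimpleGraph V) (s : ℕ) (L0 : Set V) {k : ℕ}
    (L : Fin k → Set V) : Set V :=
  L0 ∪ {v ∈ templateNbhd G L0 L |
    ∀ i : Fin k, 4 * ({u ∈ L i | ¬ G.Adj v u}).ncard ≤ G.cliqueNum ^ (s+2)}

/-- `Y(𝓛) = (V(𝓛) ∪ N(𝓛)) \ Z(𝓛)`. -/
def templateY {V : Type*} (G : SimpleGraph V) (s : ℕ) (L0 : Set V) {k : ℕ}
    (L : Fin k → Set V) : Set V :=
  (templateVerts L0 L ∪ templateNbhd G L0 L) \ templateZ G s L0 L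

/-- `N_A(𝓛)`: the vertices of `A \ V(𝓛)` with a neighbour in `L 1 ∪ ⋯ ∪ L k`. -/
def templateNbhdIn {V : Type*} (G : SimpleGraph V) (A : Set V) (L0 : Set V) {k : ℕ}
    (L : Fin k → Set V) : Set V :=
  {v ∈ A | v ∉ templateVerts L0 L ∧ ∃ i : Fin k, ∃ u ∈ L i, G.Adj v u}

/-- `Z_A(𝓛)`: the union of `L0` with the set of vertices of `A \ V(𝓛)` having at most
`ω^{s+2}/4` non-neighbours in each `L i`. -/
def templateZIn {V : Type*} (G : SimpleGraph V) (s : ℕ) (A : Set V) (L0 : Set V) {k : ℕ}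
    (L : Fin k → Set V) : Set V :=
  L0 ∪ {v ∈ A | v ∉ templateVerts L0 L ∧
    ∀ i : Fin k, 4 * ({u ∈ L i | ¬ G.Adj v u}).ncard ≤ G.cliqueNum ^ (s+2)}

/-- `Y_A(𝓛) = (V(𝓛) ∪ N_A(𝓛)) \ Z_A(𝓛)`. -/
def templateYIn {V : Type*} (G : SimpleGraph V) (s : ℕ) (A : Set V) (L0 : Set V) {k : ℕ}
    (L : Fin k → Set V) : Set V :=
  (templateVerts L0 L ∪ templateNbhdIn G A L0 L) \ templateZIn G s A L0 L

section TemplateTypesAux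

theorem tt_card_iUnion_le {V ι : Type*} [Finite V] [Fintype ι] (S : ι → Set V) (c : ℕ)
    (h : ∀ i, (S i).ncard ≤ c) : (⋃ i, S i).ncard ≤ Fintype.card ι * c := by
  classical
  have := Fintype.ofFinite V
  have e : (⋃ i, S i) = ((Finset.univ.biUnion fun i => (S i).toFinset : Finset V) : Set V) := by
    ext x; simp
  rw [e, Set.ncard_coe_finset]
  refine Finset.card_biUnion_le_card_mul _ _ _ (fun i _ => ?_)
  rw [← Set.ncard_eq_toFinset_card']; exact h i

theorem tt_double_count {V : Type*} [Finite V] (A B : Set V) (R : V → V → Prop) (c d : ℕ)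
    (h1 : ∀ a ∈ A, c ≤ ({b ∈ B | R a b}).ncard) (h2 : ∀ b ∈ B, ({a ∈ A | R a b}).ncard ≤ d) :
    A.ncard * c ≤ B.ncard * d := by
  classical
  have := Fintype.ofFinite V
  rw [Set.ncard_eq_toFinset_card' A, Set.ncard_eq_toFinset_card' B]
  refine Finset.card_mul_le_card_mul R (s := A.toFinset) (t := B.toFinset) ?_ ?_
  · intro a ha
    refine (h1 a (by simpa using ha)).trans (le_of_eq ?_)
    rw [← Set.ncard_coe_finset]; congr 1; ext x; simp [Finset.bipartiteAbove]
  · intro b hb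
    refine le_trans (le_of_eq ?_) (h2 b (by simpa using hb))
    rw [← Set.ncard_coe_finset]; congr 1; ext x; simp [Finset.bipartiteBelow]

theorem tt_ramsey {V : Type*} [Finite V] (G : SimpleGraph V) (hω : 4 ≤ G.cliqueNum) (s : ℕ) :
    ∀ X : Set V, G.cliqueNum ^ s ≤ X.ncard + 2 →
      ∃ S : Set V, S ⊆ X ∧ S.ncard = s ∧ IsStableSet G S := by
  classical
  have := Fintype.ofFinite V
  induction s with
  | zero => intro X _; exact ⟨∅, by simp, by simp, by simp [IsStableSet]⟩
  | succ s ih =>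
    intro X hX
    have hm : 1 ≤ G.cliqueNum ^ s := Nat.one_le_pow _ _ (by omega)
    rw [pow_succ] at hX
    have hXne : X.Nonempty := by
      rw [← Set.ncard_pos]; nlinarith
    obtain ⟨x0, hx0⟩ := hXne
    let F : Finset (Finset V) := Finset.univ.filter fun K => (K : Set V) ⊆ X ∧ G.IsClique (K : Set V)
    obtain ⟨K, hKF, hKmax⟩ := Finset.exists_max_image F Finset.card
      ⟨{x0}, by simp [F, hx0]⟩
    simp only [F, Finset.mem_filter, Finset.mem_univ, true_and] at hKF hKmax
    obtain ⟨hKX, hKc⟩ := hKF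
    have hK1 : 1 ≤ K.card := by
      have := hKmax {x0} (by simp [hx0]); simpa using this
    have hKN : K.card ≤ G.cliqueNum := hKc.card_le_cliqueNum
    by_cases hy : ∃ y ∈ K, G.cliqueNum ^ s ≤ ({x ∈ X | x ≠ y ∧ ¬ G.Adj y x}).ncard + 2
    · obtain ⟨y, hyK, hy⟩ := hy
      obtain ⟨S, hSX, hSc, hSs⟩ := ih _ hy
      refine ⟨insert y S, ?_, ?_, ?_⟩
      · intro z hz
        rcases hz with rfl | hz
        · exact hKX hyK
        · exact (hSX hz).1
      · rw [Set.ncard_insert_of_notMem, hSc]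
        intro h; exact (hSX h).2.1 rfl
      · rintro a (rfl | ha) b (rfl | hb) hab
        · exact absurd rfl hab
        · exact (hSX hb).2.2
        · intro h; exact (hSX ha).2.2 h.symm
        · exact hSs a ha b hb hab
    · push Not at hy
      exfalso
      have hdc := tt_double_count (X \ (K : Set V)) (K : Set V) (fun x y => x ≠ y ∧ ¬ G.Adj y x) 1
        (G.cliqueNum ^ s - 3) ?_ ?_
      · have h3 : 3 ≤ G.cliqueNum ^ s := by
          obtain ⟨y, hyK⟩ := Finset.card_pos.1 hK1
          have := hy y hyK; omega
        have h4 : X.ncard ≤ (X \ (K : Set V)).ncard + K.card := by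
          have := Set.ncard_le_ncard_sdiff_add_ncard X (K : Set V)
          rwa [Set.ncard_coe_finset] at this
        rw [Set.ncard_coe_finset] at hdc
        obtain ⟨q, hq⟩ := Nat.exists_eq_add_of_le h3
        rw [hq] at hdc hX
        simp only [Nat.add_sub_cancel_left] at hdc
        nlinarith
      · intro x hx
        rw [Nat.one_le_iff_ne_zero, ← Nat.pos_iff_ne_zero, Set.ncard_pos]
        by_contra hne
        rw [Set.not_nonempty_iff_eq_empty] at hne
        have hall : ∀ y ∈ K, x ≠ y → G.Adj y x := by
          intro y hyK hxy
          by_contra hn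
          have : y ∈ ({b ∈ (K : Set V) | x ≠ b ∧ ¬ G.Adj b x}) := ⟨hyK, hxy, hn⟩
          rw [hne] at this; exact this
        have hxK : x ∉ K := fun h => hx.2 h
        have := hKmax (insert x K) ⟨by
          intro z hz
          simp only [Finset.coe_insert] at hz
          rcases hz with rfl | hz
          · exact hx.1
          · exact hKX hz, by
          rw [Finset.coe_insert]
          refine hKc.insert (fun b hb hne => (hall b hb hne).symm)⟩
        rw [Finset.card_insert_of_notMem hxK] at this
        omega
      · intro y hyK
        have := hy y hyK
        have h5 : ({a ∈ X \ (K : Set V) | a ≠ y ∧ ¬ G.Adj y a}).ncard ≤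
          ({x ∈ X | x ≠ y ∧ ¬ G.Adj y x}).ncard := 
          Set.ncard_le_ncard (fun z hz => ⟨hz.1.1, hz.2⟩)
        omega

/-- Optimality against templates indexed by an arbitrary finite type. -/
theorem tt_opt {V : Type*} [Finite V] {G : SimpleGraph V} {s : ℕ} {L0 : Set V} {k : ℕ}
    {L : Fin k → Set V} (hT : IsOptimalTemplate G s L0 L) {ι : Type*} [Fintype ι]
    (M0 : Set V) (M : ι → Set V)
    (h1 : ∀ i, Disjoint M0 (M i)) (h2 : ∀ i j, i ≠ j → Disjoint (M i) (M j))
    (h3 : G.IsClique M0) (h4 : ∀ u ∈ M0, ∀ i, ∀ v ∈ M i, G.Adj u v)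
    (h5 : ∀ i, G.cliqueNum ^ (s+5) ≤ (M i).ncard ∧ (M i).ncard ≤ 14 * G.cliqueNum ^ (s+6))
    (h6 : ∀ i j, i ≠ j → ∀ v ∈ M i, ({u ∈ M j | ¬ G.Adj v u}).ncard ≤ G.cliqueNum ^ (s+3)) :
    (⋃ i, M i).ncard + 7 * G.cliqueNum ^ (s+5) * M0.ncard + Fintype.card ι * G.cliqueNum ^ (s+5)
      ≤ templateValue G s L0 L := by
  let e := (Fintype.equivFin ι).symm
  have := hT.2 (Fintype.card ι) M0 (fun i => M (e i)) ⟨fun i => h1 _, fun i j hij =>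
    h2 _ _ (fun h => hij (e.injective h)), h3, fun u hu i => h4 u hu _, fun i => h5 _,
    fun i j hij => h6 _ _ (fun h => hij (e.injective h))⟩
  unfold templateValue at this ⊢
  rwa [e.surjective.iUnion_comp M] at this

theorem tt_transversal {V : Type*} [Finite V] {G : SimpleGraph V} {s : ℕ} {L0 : Set V} {k : ℕ}
    {L : Fin k → Set V} (hω : 200 ≤ G.cliqueNum) (hT : IsTemplate G s L0 L) (J : Finset (Fin k)) :
    J.card ≤ G.cliqueNum + 1 → ∃ f : Fin k → V, (∀ i ∈ J, f i ∈ L i) ∧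
      ∀ i ∈ J, ∀ j ∈ J, i ≠ j → G.Adj (f i) (f j) := by
  classical
  obtain ⟨-, -, -, -, h5, h6⟩ := hT
  induction J using Finset.induction_on with
  | empty =>
    intro _
    refine ⟨fun i => ?_, by simp, by simp⟩
    have : (L i).Nonempty := by
      rw [← Set.ncard_pos]
      exact lt_of_lt_of_le (by positivity) (h5 i).1
    exact this.some
  | insert a J ha ih =>
    intro hc
    rw [Finset.card_insert_of_notMem ha] at hc
    obtain ⟨f, hf1, hf2⟩ := ih (by omega)
    have hbad : (⋃ j : J, {u ∈ L a | ¬ G.Adj (f j) u}).ncard ≤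
        Fintype.card J * G.cliqueNum ^ (s+3) :=
      tt_card_iUnion_le _ _ (fun j => h6 j a (fun h => ha (h ▸ j.2)) _ (hf1 _ j.2))
    have hlt : (⋃ j : J, {u ∈ L a | ¬ G.Adj (f j) u}).ncard < (L a).ncard := by
      refine lt_of_le_of_lt hbad (lt_of_lt_of_le ?_ (h5 a).1)
      rw [Fintype.card_coe, show s + 5 = 2 + (s+3) by ring, pow_add _ 2]
      apply Nat.mul_lt_mul_of_pos_right _ (by positivity)
      nlinarith
    obtain ⟨y, hyL, hy⟩ := Set.exists_mem_notMem_of_ncard_lt_ncard hlt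
    have hy' : ∀ j ∈ J, G.Adj (f j) y := by
      intro j hj
      by_contra hn
      exact hy (Set.mem_iUnion.2 ⟨⟨j, hj⟩, hyL, hn⟩)
    refine ⟨Function.update f a y, ?_, ?_⟩
    · intro i hi
      by_cases hia : i = a
      · subst hia; simpa using hyL
      · rw [Function.update_of_ne hia]; exact hf1 i (Finset.mem_of_mem_insert_of_ne hi hia)
    · intro i hi j hj hij
      by_cases hia : i = a
      · subst hia
        have hji : j ≠ i := Ne.symm hij
        rw [Function.update_self, Function.update_of_ne hji]
        exact (hy' j (Finset.mem_of_mem_insert_of_ne hj hji)).symm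
      · rw [Function.update_of_ne hia]
        have hiJ := Finset.mem_of_mem_insert_of_ne hi hia
        by_cases hja : j = a
        · subst hja; rw [Function.update_self]; exact hy' i hiJ
        · rw [Function.update_of_ne hja]
          exact hf2 i hiJ j (Finset.mem_of_mem_insert_of_ne hj hja) hij

theorem tt_k_le {V : Type*} [Finite V] {G : SimpleGraph V} {s : ℕ} {L0 : Set V} {k : ℕ}
    {L : Fin k → Set V} (hω : 200 ≤ G.cliqueNum) (hT : IsTemplate G s L0 L) :
    k ≤ G.cliqueNum := by
  classical
  have := Fintype.ofFinite V
  by_contra hk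
  push Not at hk
  obtain ⟨J, -, hJ⟩ := Finset.exists_subset_card_eq (s := (Finset.univ : Finset (Fin k)))
    (n := G.cliqueNum + 1) (by simpa using hk)
  obtain ⟨f, -, hf⟩ := tt_transversal hω hT J (le_of_eq hJ)
  have hcl : G.IsClique ((J.image f : Finset V) : Set V) := by
    intro a ha b hb hab
    simp only [Finset.coe_image, Set.mem_image, Finset.mem_coe] at ha hb
    obtain ⟨i, hi, rfl⟩ := ha
    obtain ⟨j, hj, rfl⟩ := hb
    exact hf i hi j hj (fun h => hab (by rw [h]))
  have h1 := hcl.card_le_cliqueNum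
  rw [Finset.card_image_of_injOn, hJ] at h1
  · omega
  · intro i hi j hj hij
    by_contra hne
    exact (hf i hi j hj hne).ne hij

/-- In an optimal template all parts are large. -/
theorem tt_large {V : Type*} [Finite V] {G : SimpleGraph V} {s : ℕ} {L0 : Set V} {k : ℕ}
    {L : Fin k → Set V} (hω : 200 ≤ G.cliqueNum) (hT : IsOptimalTemplate G s L0 L) (i : Fin k) :
    5 * G.cliqueNum ^ (s+5) ≤ (L i).ncard := by
  classical
  by_contra hi
  push Not at hi
  have hk := tt_k_le hω hT.1
  obtain ⟨h1, h2, h3, h4, h5, h6⟩ := id hT.1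
  let J : Finset (Fin k) := Finset.univ.filter fun i => (L i).ncard < 5 * G.cliqueNum ^ (s+5)
  have hJk : J.card ≤ k := by simpa using Finset.card_le_univ J
  have hJ1 : 1 ≤ J.card := Finset.card_pos.2 ⟨i, by simpa [J] using hi⟩
  obtain ⟨f, hf1, hf2⟩ := tt_transversal hω hT.1 J (by omega)
  have e4 : G.cliqueNum * G.cliqueNum ^ (s+3) = G.cliqueNum ^ (s+4) := by ring
  have e5 : G.cliqueNum * G.cliqueNum ^ (s+4) = G.cliqueNum ^ (s+5) := by ring
  have p4 : 0 < G.cliqueNum ^ (s+4) := by positivity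
  let M : {i // i ∉ J} → Set V := fun i => {w ∈ L i | ∀ j ∈ J, G.Adj (f j) w}
  have hML : ∀ i, M i ⊆ L i := fun i w hw => hw.1
  have hfinj : Set.InjOn f J := by
    intro i hi j hj hij
    by_contra hne
    exact (hf2 i hi j hj hne).ne hij
  have hL0f : Disjoint L0 (f '' (J : Set (Fin k))) := by
    rw [Set.disjoint_left]
    rintro a ha ⟨j, hj, rfl⟩
    exact Set.disjoint_left.1 (h1 j) ha (hf1 j hj)
  have hsize : ∀ i : {i // i ∉ J}, (L i).ncard ≤ (M i).ncard + G.cliqueNum ^ (s+4) := by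
    intro i
    have hb : (⋃ j : J, {u ∈ L i | ¬ G.Adj (f j) u}).ncard ≤
        Fintype.card J * G.cliqueNum ^ (s+3) :=
      tt_card_iUnion_le _ _ (fun j => h6 j i (fun h => i.2 (h ▸ j.2)) _ (hf1 _ j.2))
    rw [Fintype.card_coe] at hb
    have hsub : L i ⊆ M i ∪ ⋃ j : J, {u ∈ L i | ¬ G.Adj (f j) u} := by
      intro w hw
      by_cases hm : w ∈ M i
      · exact Or.inl hm
      · right
        simp only [M, Set.mem_setOf_eq, not_and, not_forall] at hm
        obtain ⟨j, hj, hn⟩ := hm hw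
        exact Set.mem_iUnion.2 ⟨⟨j, hj⟩, hw, hn⟩
    have := (Set.ncard_le_ncard hsub).trans (Set.ncard_union_le _ _)
    have : J.card * G.cliqueNum ^ (s+3) ≤ G.cliqueNum * G.cliqueNum ^ (s+3) :=
      Nat.mul_le_mul_right _ (by omega)
    omega
  have hv := tt_opt hT (L0 ∪ f '' (J : Set (Fin k))) M ?_ ?_ ?_ ?_ ?_ ?_
  · rw [Set.ncard_union_eq hL0f, Set.ncard_image_of_injOn hfinj, Set.ncard_coe_finset] at hv
    have hcard : Fintype.card {i // i ∉ J} + J.card = k := by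
      rw [Fintype.card_subtype_compl]; simp; omega
    have hlost : (⋃ j : J, (L j ∪ ⋃ i : {i : Fin k // i ≠ j},
        {u ∈ L i | ¬ G.Adj (f j) u})).ncard ≤
        Fintype.card J * (5 * G.cliqueNum ^ (s+5) + G.cliqueNum ^ (s+4)) := by
      refine tt_card_iUnion_le _ _ (fun j => (Set.ncard_union_le _ _).trans ?_)
      have hj : (L j).ncard < 5 * G.cliqueNum ^ (s+5) := by
        have := j.2
        simp only [J, Finset.mem_filter] at this
        exact this.2
      have hb := tt_card_iUnion_le (fun i : {i : Fin k // i ≠ j} =>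
        {u ∈ L i | ¬ G.Adj (f j) u}) (G.cliqueNum ^ (s+3))
        (fun i => h6 j i i.2.symm _ (hf1 _ j.2))
      have hc : Fintype.card {i : Fin k // i ≠ j} ≤ k := by
        simpa using Fintype.card_subtype_le (fun i : Fin k => i ≠ j)
      have : Fintype.card {i : Fin k // i ≠ j} * G.cliqueNum ^ (s+3)
          ≤ G.cliqueNum * G.cliqueNum ^ (s+3) :=
        Nat.mul_le_mul_right _ (by omega)
      omega
    rw [Fintype.card_coe] at hlost
    have hsub : (⋃ i, L i) ⊆ (⋃ i, M i) ∪ ⋃ j : J, (L j ∪ ⋃ i : {i : Fin k // i ≠ j},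
        {u ∈ L i | ¬ G.Adj (f j) u}) := by
      intro w hw
      obtain ⟨i, hwi⟩ := Set.mem_iUnion.1 hw
      by_cases hiJ : i ∈ J
      · right; exact Set.mem_iUnion.2 ⟨⟨i, hiJ⟩, Or.inl hwi⟩
      by_cases hm : ∀ j ∈ J, G.Adj (f j) w
      · left; exact Set.mem_iUnion.2 ⟨⟨i, hiJ⟩, hwi, hm⟩
      · right
        push Not at hm
        obtain ⟨j, hj, hn⟩ := hm
        refine Set.mem_iUnion.2 ⟨⟨j, hj⟩, Or.inr (Set.mem_iUnion.2 ⟨⟨i, fun h => hiJ ?_⟩, hwi, hn⟩)⟩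
        rw [h]; exact hj
    have hU := (Set.ncard_le_ncard hsub).trans (Set.ncard_union_le _ _)
    unfold templateValue at hv
    have hcard2 : Fintype.card {i // i ∉ J} * G.cliqueNum ^ (s+5) +
        J.card * G.cliqueNum ^ (s+5) = k * G.cliqueNum ^ (s+5) := by
      rw [← add_mul, hcard]
    have : G.cliqueNum ^ (s+4) < G.cliqueNum ^ (s+5) := by nlinarith
    have : J.card * G.cliqueNum ^ (s+4) < J.card * G.cliqueNum ^ (s+5) :=
      Nat.mul_lt_mul_of_pos_left this hJ1
    nlinarith
  · intro i
    rw [Set.disjoint_union_left]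
    refine ⟨(h1 i).mono_right (hML i), ?_⟩
    rw [Set.disjoint_left]
    rintro a ⟨j, hj, rfl⟩ ha
    exact (G.irrefl (ha.2 j hj))
  · intro i j hij
    exact (h2 (fun h => hij (Subtype.ext h))).mono (hML i) (hML j)
  · rintro a (ha | ⟨i, hi, rfl⟩) b (hb | ⟨j, hj, rfl⟩) hab
    · exact h3 ha hb hab
    · exact h4 a ha j _ (hf1 j hj)
    · exact (h4 b hb i _ (hf1 i hi)).symm
    · exact hf2 i hi j hj (fun h => hab (by rw [h]))
  · rintro a (ha | ⟨j, hj, rfl⟩) i w hw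
    · exact h4 a ha i w hw.1
    · exact hw.2 j hj
  · intro i
    have hh : 5 * G.cliqueNum ^ (s+5) ≤ (L i).ncard := by
      have := i.2
      simpa [J] using this
    have := hsize i
    have : G.cliqueNum ^ (s+4) ≤ G.cliqueNum ^ (s+5) := by nlinarith
    exact ⟨by omega, (Set.ncard_le_ncard (hML i)).trans (h5 i).2⟩
  · intro i j hij w hw
    refine le_trans (Set.ncard_le_ncard ?_) (h6 i j (fun h => hij (Subtype.ext h)) w hw.1)
    exact fun z hz => ⟨hz.1.1, hz.2⟩

/-- Every vertex of a part has many non-neighbours in its part. -/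
theorem tt_nonnbr {V : Type*} [Finite V] {G : SimpleGraph V} {s : ℕ} {L0 : Set V} {k : ℕ}
    {L : Fin k → Set V} (hω : 200 ≤ G.cliqueNum) (hT : IsOptimalTemplate G s L0 L) (i : Fin k)
    (x : V) (hx : x ∈ L i) :
    3 * G.cliqueNum ^ (s+5) < ({w ∈ L i | ¬ G.Adj x w}).ncard := by
  classical
  by_contra hi
  push Not at hi
  have hk := tt_k_le hω hT.1
  have hlarge := tt_large hω hT
  obtain ⟨h1, h2, h3, h4, h5, h6⟩ := id hT.1
  have e4 : G.cliqueNum * G.cliqueNum ^ (s+3) = G.cliqueNum ^ (s+4) := by ring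
  have e5 : G.cliqueNum * G.cliqueNum ^ (s+4) = G.cliqueNum ^ (s+5) := by ring
  have p3 : 0 < G.cliqueNum ^ (s+3) := by positivity
  have l4 : 200 * G.cliqueNum ^ (s+3) ≤ G.cliqueNum ^ (s+4) := by nlinarith
  have l5 : 200 * G.cliqueNum ^ (s+4) ≤ G.cliqueNum ^ (s+5) := by nlinarith
  let M : Fin k → Set V := fun j => {w ∈ L j | G.Adj x w}
  have hML : ∀ i, M i ⊆ L i := fun i w hw => hw.1
  have hxL0 : x ∉ L0 := fun h => Set.disjoint_left.1 (h1 i) h hx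
  have hv := tt_opt hT (insert x L0) M ?_ ?_ ?_ ?_ ?_ ?_
  · rw [Set.ncard_insert_of_notMem hxL0, Fintype.card_fin] at hv
    have hb := tt_card_iUnion_le (fun j : {j : Fin k // j ≠ i} =>
        {u ∈ L j | ¬ G.Adj x u}) (G.cliqueNum ^ (s+3))
        (fun j => h6 i j j.2.symm _ hx)
    have hc : Fintype.card {j : Fin k // j ≠ i} ≤ k := by
      simpa using Fintype.card_subtype_le (fun j : Fin k => j ≠ i)
    have : Fintype.card {j : Fin k // j ≠ i} * G.cliqueNum ^ (s+3)
        ≤ G.cliqueNum * G.cliqueNum ^ (s+3) :=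
      Nat.mul_le_mul_right _ (by omega)
    have hsub : (⋃ i, L i) ⊆ ((⋃ i, M i) ∪ {w ∈ L i | ¬ G.Adj x w}) ∪
        ⋃ j : {j : Fin k // j ≠ i}, {u ∈ L j | ¬ G.Adj x u} := by
      intro w hw
      obtain ⟨j, hwj⟩ := Set.mem_iUnion.1 hw
      by_cases ha : G.Adj x w
      · left; left; exact Set.mem_iUnion.2 ⟨j, hwj, ha⟩
      by_cases hji : j = i
      · subst hji; left; right; exact ⟨hwj, ha⟩
      · right; exact Set.mem_iUnion.2 ⟨⟨j, hji⟩, hwj, ha⟩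
    have hU := (Set.ncard_le_ncard hsub).trans (Set.ncard_union_le _ _)
    have hU2 := Set.ncard_union_le (⋃ i, M i) {w ∈ L i | ¬ G.Adj x w}
    unfold templateValue at hv
    nlinarith
  · intro j
    rw [Set.disjoint_insert_left]
    exact ⟨fun h => G.irrefl h.2, (h1 j).mono_right (hML j)⟩
  · intro a b hab
    exact (h2 hab).mono (hML a) (hML b)
  · exact h3.insert (fun b hb _ => (h4 b hb i x hx).symm)
  · rintro a (rfl | ha) j w hw
    · exact hw.2
    · exact h4 a ha j w hw.1
  · intro j
    refine ⟨?_, (Set.ncard_le_ncard (hML j)).trans (h5 j).2⟩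
    have hsub : L j ⊆ M j ∪ {w ∈ L j | ¬ G.Adj x w} := by
      intro w hw
      by_cases ha : G.Adj x w
      · left; exact ⟨hw, ha⟩
      · right; exact ⟨hw, ha⟩
    have hU := (Set.ncard_le_ncard hsub).trans (Set.ncard_union_le _ _)
    have hl := hlarge j
    by_cases hji : j = i
    · subst hji; omega
    · have := h6 i j (Ne.symm hji) x hx
      omega
  · intro a b hab w hw
    refine le_trans (Set.ncard_le_ncard ?_) (h6 a b hab w hw.1)
    exact fun z hz => ⟨hz.1.1, hz.2⟩

/-- A part of an optimal template cannot be split in two. -/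
theorem tt_split {V : Type*} [Finite V] {G : SimpleGraph V} {s : ℕ} {L0 : Set V} {k : ℕ}
    {L : Fin k → Set V} (hT : IsOptimalTemplate G s L0 L) (i : Fin k)
    (P Q : Set V) (hP : P ⊆ L i) (hQ : Q ⊆ L i) (hPQ : Disjoint P Q)
    (hP5 : G.cliqueNum ^ (s+5) ≤ P.ncard) (hQ5 : G.cliqueNum ^ (s+5) ≤ Q.ncard)
    (hPn : ∀ p ∈ P, ({q ∈ Q | ¬ G.Adj p q}).ncard ≤ G.cliqueNum ^ (s+3))
    (hQn : ∀ q ∈ Q, ({p ∈ P | ¬ G.Adj q p}).ncard ≤ G.cliqueNum ^ (s+3))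
    (hlost : (L i).ncard < P.ncard + Q.ncard + G.cliqueNum ^ (s+5)) : False := by
  classical
  obtain ⟨h1, h2, h3, h4, h5, h6⟩ := id hT.1
  let c : Option (Fin k) → Fin k := fun o => o.getD i
  let M : Option (Fin k) → Set V := fun o => o.elim Q (fun j => if j = i then P else L j)
  have hMn : M none = Q := rfl
  have hMi : M (some i) = P := by simp [M]
  have hMj : ∀ j, j ≠ i → M (some j) = L j := fun j hj => by simp [M, hj]
  have hML : ∀ o, M o ⊆ L (c o) := by
    rintro (_ | j)
    · exact hQ
    · by_cases hj : j = i
      · subst hj; rw [hMi]; exact hP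
      · rw [hMj j hj]; exact subset_rfl
  -- pairs in the same old part
  have hcases : ∀ o o', o ≠ o' → c o ≠ c o' ∨ (M o = P ∧ M o' = Q) ∨ (M o = Q ∧ M o' = P) := by
    rintro (_ | j) (_ | j') hne
    · exact absurd rfl hne
    · by_cases hj : j' = i
      · subst hj; exact Or.inr (Or.inr ⟨hMn, hMi⟩)
      · exact Or.inl (fun h => hj h.symm)
    · by_cases hj : j = i
      · subst hj; exact Or.inr (Or.inl ⟨hMi, hMn⟩)
      · exact Or.inl (fun h => hj h)
    · exact Or.inl (fun h => hne (congrArg some h))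
  have hv := tt_opt hT L0 M ?_ ?_ h3 ?_ ?_ ?_
  · rw [Fintype.card_option, Fintype.card_fin] at hv
    have hsub : (⋃ j, L j) ⊆ (⋃ o, M o) ∪ (L i \ (P ∪ Q)) := by
      intro w hw
      obtain ⟨j, hwj⟩ := Set.mem_iUnion.1 hw
      by_cases hj : j = i
      · subst hj
        by_cases hwP : w ∈ P
        · left; exact Set.mem_iUnion.2 ⟨some j, by rw [hMi]; exact hwP⟩
        by_cases hwQ : w ∈ Q
        · left; exact Set.mem_iUnion.2 ⟨none, hwQ⟩
        · right; exact ⟨hwj, by simp [hwP, hwQ]⟩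
      · left; exact Set.mem_iUnion.2 ⟨some j, by rw [hMj j hj]; exact hwj⟩
    have hU := (Set.ncard_le_ncard hsub).trans (Set.ncard_union_le _ _)
    have hd := Set.ncard_diff_add_ncard_of_subset (Set.union_subset hP hQ)
    rw [Set.ncard_union_eq hPQ] at hd
    unfold templateValue at hv
    rw [add_mul] at hv
    omega
  · intro o; exact (h1 _).mono_right (hML o)
  · intro o o' hne
    rcases hcases o o' hne with h | ⟨ha, hb⟩ | ⟨ha, hb⟩
    · exact (h2 h).mono (hML o) (hML o')
    · rw [ha, hb]; exact hPQ
    · rw [ha, hb]; exact hPQ.symm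
  · intro u hu o w hw; exact h4 u hu _ w (hML o hw)
  · intro o
    refine ⟨?_, (Set.ncard_le_ncard (hML o)).trans (h5 _).2⟩
    rcases o with _ | j
    · exact hQ5
    · by_cases hj : j = i
      · subst hj; rw [hMi]; exact hP5
      · rw [hMj j hj]; exact (h5 j).1
  · intro o o' hne w hw
    rcases hcases o o' hne with h | ⟨ha, hb⟩ | ⟨ha, hb⟩
    · refine le_trans (Set.ncard_le_ncard ?_) (h6 _ _ h w (hML o hw))
      exact fun z hz => ⟨hML o' hz.1, hz.2⟩
    · rw [hb]; rw [ha] at hw; exact hPn w hw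
    · rw [hb]; rw [ha] at hw; exact hQn w hw

/-- Consequence of not being pendant. -/
theorem tt_not_pendant {V : Type*} [Finite V] {G : SimpleGraph V} {s : ℕ} {k : ℕ}
    {L : Fin k → Set V} (hω : 200 ≤ G.cliqueNum) {v : V} (hnp : ¬ TemplatePendant G s L v)
    {i j : Fin k} (hij : i ≠ j) {u x : V} (hu : u ∈ L j) (hvu : ¬ G.Adj v u) (hx : x ∈ L i)
    (hvx : G.Adj v x) (hux : G.Adj u x) :
    ({w ∈ L i | (G.Adj u w ∧ ¬ G.Adj v w) ∧ ¬ G.Adj x w}).ncard < G.cliqueNum ^ s := by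
  by_contra hn
  push Not at hn
  obtain ⟨S, hSX, hSc, hSs⟩ := tt_ramsey G (by omega) s _ (hn.trans (Nat.le_add_right _ 2))
  have hxS : x ∉ S := fun h => (hSX h).2.1.2 hvx
  refine hnp ⟨i, j, hij, u, hu, insert x S, ?_, ?_, ?_, ?_, hvu, ?_⟩
  · rintro z (rfl | hz)
    · exact hx
    · exact (hSX hz).1
  · rw [Set.ncard_insert_of_notMem hxS, hSc]
  · rintro a (rfl | ha) b (rfl | hb) hab
    · exact absurd rfl hab
    · exact (hSX hb).2.2
    · intro h; exact (hSX ha).2.2 h.symm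
    · exact hSs a ha b hb hab
  · rintro z (rfl | hz)
    · exact hux
    · exact (hSX hz).2.1.1
  · rw [Set.ncard_eq_one]
    refine ⟨x, ?_⟩
    ext z
    simp only [Set.mem_insert_iff, Set.mem_setOf_eq, Set.mem_singleton_iff]
    constructor
    · rintro ⟨rfl | hz, hvz⟩
      · rfl
      · exact absurd hvz (hSX hz).2.1.2
    · rintro rfl; exact ⟨Or.inl rfl, hvx⟩

theorem tt_key {V : Type*} [Finite V] {G : SimpleGraph V} {s : ℕ} {L0 : Set V} {k : ℕ}
    {L : Fin k → Set V} (hω : 200 ≤ G.cliqueNum) (hT : IsOptimalTemplate G s L0 L) {v : V}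
    (hnp : ¬ TemplatePendant G s L v) (hnd : ¬ TemplateDense G s L v)
    {i j : Fin k} (hij : i ≠ j) {u x : V} (hu : u ∈ L j) (hvu : ¬ G.Adj v u) (hx : x ∈ L i)
    (hvx : G.Adj v x) :
    14 * ({w ∈ L i | G.Adj u w ∧ ¬ G.Adj v w}).ncard < G.cliqueNum ^ (s+2) := by
  classical
  have hnn := tt_nonnbr hω hT i
  obtain ⟨h1, h2, h3, h4, h5, h6⟩ := id hT.1
  have e1 : G.cliqueNum * G.cliqueNum ^ s = G.cliqueNum ^ (s+1) := by ring
  have e2 : G.cliqueNum * G.cliqueNum ^ (s+1) = G.cliqueNum ^ (s+2) := by ring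
  have e3 : G.cliqueNum * G.cliqueNum ^ (s+2) = G.cliqueNum ^ (s+3) := by ring
  have e4 : G.cliqueNum * G.cliqueNum ^ (s+3) = G.cliqueNum ^ (s+4) := by ring
  have e5 : G.cliqueNum * G.cliqueNum ^ (s+4) = G.cliqueNum ^ (s+5) := by ring
  have p0 : 0 < G.cliqueNum ^ s := by positivity
  have l1 : 200 * G.cliqueNum ^ s ≤ G.cliqueNum ^ (s+1) := by nlinarith
  have l2 : 200 * G.cliqueNum ^ (s+1) ≤ G.cliqueNum ^ (s+2) := by nlinarith
  have l3 : 200 * G.cliqueNum ^ (s+2) ≤ G.cliqueNum ^ (s+3) := by nlinarith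
  have l4 : 200 * G.cliqueNum ^ (s+3) ≤ G.cliqueNum ^ (s+4) := by nlinarith
  have l5 : 200 * G.cliqueNum ^ (s+4) ≤ G.cliqueNum ^ (s+5) := by nlinarith
  by_contra hbig
  push Not at hbig
  set P : Set V := {w ∈ L i | G.Adj u w ∧ ¬ G.Adj v w} with hPdef
  set Q : Set V := {w ∈ L i | G.Adj u w ∧ G.Adj v w} with hQdef
  set U : Set V := {w ∈ L i | ¬ G.Adj u w} with hUdef
  have hU : U.ncard ≤ G.cliqueNum ^ (s+3) := h6 j i hij.symm u hu
  have hPL : P ⊆ L i := fun w hw => hw.1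
  have hQL : Q ⊆ L i := fun w hw => hw.1
  have hPQ : Disjoint P Q := Set.disjoint_left.2 (fun w hw hw' => hw.2.2 hw'.2.2)
  have hLsub : L i ⊆ (P ∪ Q) ∪ U := by
    intro w hw
    by_cases a : G.Adj u w
    · by_cases b : G.Adj v w
      · exact Or.inl (Or.inr ⟨hw, a, b⟩)
      · exact Or.inl (Or.inl ⟨hw, a, b⟩)
    · exact Or.inr ⟨hw, a⟩
  have hLcard : (L i).ncard ≤ P.ncard + Q.ncard + U.ncard :=
    (Set.ncard_le_ncard hLsub).trans ((Set.ncard_union_le _ _).trans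
      (Nat.add_le_add_right (Set.ncard_union_le _ _) _))
  -- each vertex in `Q` has few non-neighbours in `P`
  have hQP : ∀ q ∈ Q, ({p ∈ P | ¬ G.Adj q p}).ncard < G.cliqueNum ^ s := by
    intro q hq
    refine lt_of_le_of_lt (Set.ncard_le_ncard ?_)
      (tt_not_pendant hω hnp hij hu hvu hq.1 hq.2.2 hq.2.1)
    exact fun z hz => ⟨hz.1.1, hz.1.2, hz.2⟩
  -- `Q` is large
  have hQbig : 2 * G.cliqueNum ^ (s+5) ≤ Q.ncard := by
    have : ∃ j', j' ≠ i ∧ G.cliqueNum ^ (s+2) ≤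
        14 * ({w ∈ L j' | G.Adj x w ∧ ¬ G.Adj v w}).ncard := by
      by_contra hc
      push Not at hc
      exact hnd ⟨i, x, hx, hc⟩
    obtain ⟨j', hj', hcard⟩ := this
    have hne : ({w ∈ L j' | G.Adj x w ∧ ¬ G.Adj v w}).Nonempty := by
      rw [← Set.ncard_pos]; omega
    obtain ⟨u', hu', hxu', hvu'⟩ := hne
    have hA := tt_not_pendant hω hnp hj'.symm hu' hvu' hx hvx hxu'.symm
    have hB := h6 j' i hj' u' hu'
    have hC := hnn x hx
    have hsub : {w ∈ L i | ¬ G.Adj x w} ⊆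
        (({w ∈ L i | (G.Adj u' w ∧ ¬ G.Adj v w) ∧ ¬ G.Adj x w} ∪ {w ∈ L i | ¬ G.Adj u' w}) ∪ Q)
          ∪ U := by
      intro w hw
      by_cases a : G.Adj u w
      · by_cases b : G.Adj v w
        · exact Or.inl (Or.inr ⟨hw.1, a, b⟩)
        · by_cases c : G.Adj u' w
          · exact Or.inl (Or.inl (Or.inl ⟨hw.1, ⟨c, b⟩, hw.2⟩))
          · exact Or.inl (Or.inl (Or.inr ⟨hw.1, c⟩))
      · exact Or.inr ⟨hw.1, a⟩
    have hD := (Set.ncard_le_ncard hsub).trans ((Set.ncard_union_le _ _).trans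
      (Nat.add_le_add_right ((Set.ncard_union_le _ _).trans
      (Nat.add_le_add_right (Set.ncard_union_le _ _) _)) _))
    omega
  have hQmax : Q.ncard ≤ 14 * G.cliqueNum ^ (s+6) := (Set.ncard_le_ncard hQL).trans (h5 i).2
  by_cases hPs : P.ncard ≤ 2 * G.cliqueNum ^ (s+5) - G.cliqueNum ^ (s+3)
  · -- some vertex of `P` has few non-neighbours in `Q`
    have hall : ∀ p ∈ P, G.cliqueNum ^ (s+5) ≤ ({q ∈ Q | ¬ G.Adj p q}).ncard := by
      intro p hp
      have hC := hnn p hp.1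
      have hsub : {w ∈ L i | ¬ G.Adj p w} ⊆ (P ∪ {q ∈ Q | ¬ G.Adj p q}) ∪ U := by
        intro w hw
        rcases hLsub hw.1 with (h | h) | h
        · exact Or.inl (Or.inl h)
        · exact Or.inl (Or.inr ⟨h, hw.2⟩)
        · exact Or.inr h
      have hD := (Set.ncard_le_ncard hsub).trans ((Set.ncard_union_le _ _).trans
        (Nat.add_le_add_right (Set.ncard_union_le _ _) _))
      omega
    have hdc := tt_double_count P Q (fun p q => ¬ G.Adj p q) _ (G.cliqueNum ^ s) hall
      (fun q hq => by
        have := hQP q hq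
        simp only [G.adj_comm q] at this
        exact this.le)
    have h7 : G.cliqueNum ^ (s+2) * G.cliqueNum ^ (s+5) ≤
        14 * (14 * G.cliqueNum ^ (s+6)) * G.cliqueNum ^ s := by
      calc _ ≤ 14 * P.ncard * G.cliqueNum ^ (s+5) := Nat.mul_le_mul_right _ hbig
        _ = 14 * (P.ncard * G.cliqueNum ^ (s+5)) := by ring
        _ ≤ 14 * (Q.ncard * G.cliqueNum ^ s) := Nat.mul_le_mul_left _ hdc
        _ ≤ 14 * (14 * G.cliqueNum ^ (s+6) * G.cliqueNum ^ s) :=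
          Nat.mul_le_mul_left _ (Nat.mul_le_mul_right _ hQmax)
        _ = _ := by ring
    have e7 : G.cliqueNum ^ (s+2) * G.cliqueNum ^ (s+5) =
        G.cliqueNum * (G.cliqueNum ^ (s+6) * G.cliqueNum ^ s) := by ring
    have p7 : 0 < G.cliqueNum ^ (s+6) * G.cliqueNum ^ s := by positivity
    nlinarith
  · push Not at hPs
    set P' : Set V := {p ∈ P | ({q ∈ Q | ¬ G.Adj p q}).ncard ≤ G.cliqueNum ^ (s+3)} with hP'
    set R : Set V := {p ∈ P | ¬ ({q ∈ Q | ¬ G.Adj p q}).ncard ≤ G.cliqueNum ^ (s+3)} with hR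
    have hPc : P.ncard ≤ P'.ncard + R.ncard := by
      refine (Set.ncard_le_ncard ?_).trans (Set.ncard_union_le _ _)
      intro p hp
      by_cases h : ({q ∈ Q | ¬ G.Adj p q}).ncard ≤ G.cliqueNum ^ (s+3)
      · exact Or.inl ⟨hp, h⟩
      · exact Or.inr ⟨hp, h⟩
    have hdc := tt_double_count R Q (fun p q => ¬ G.Adj p q) (G.cliqueNum ^ (s+3)) (G.cliqueNum ^ s)
      (fun p hp => (not_le.1 hp.2).le)
      (fun q hq => by
        have := hQP q hq
        simp only [G.adj_comm q] at this
        refine le_trans (Set.ncard_le_ncard ?_) this.le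
        exact fun z hz => ⟨hz.1.1, hz.2⟩)
    have hRc : R.ncard ≤ 14 * G.cliqueNum ^ (s+3) := by
      have e : 14 * G.cliqueNum ^ (s+6) * G.cliqueNum ^ s =
        (14 * G.cliqueNum ^ (s+3)) * G.cliqueNum ^ (s+3) := by ring
      have : R.ncard * G.cliqueNum ^ (s+3) ≤
          (14 * G.cliqueNum ^ (s+3)) * G.cliqueNum ^ (s+3) := by
        rw [← e]
        exact hdc.trans (Nat.mul_le_mul_right _ hQmax)
      exact Nat.le_of_mul_le_mul_right this (by positivity)
    have hP'P : P' ⊆ P := fun p hp => hp.1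
    refine tt_split hT i P' Q (hP'P.trans hPL) hQL (hPQ.mono_left hP'P) (by omega) (by omega)
      (fun p hp => hp.2) (fun q hq => ?_) (by omega)
    refine (Set.ncard_le_ncard ?_).trans ((hQP q hq).le.trans (by omega))
    exact fun z hz => ⟨hz.1.1, hz.2⟩

end TemplateTypesAux

/-- If `G` is `H_s`-free with `ω ≥ 200` and `𝓛` is an optimal `s`-template of value at least
`28 ω^{s+6}`, then every vertex of `N(𝓛)` is pendant, dense or pure. -/
theorem template_types {V : Type*} [Fintype V] (G : SimpleGraph V) (s : ℕ) (hs : 1 ≤ s)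
    (hfree : IsInducedFree G (doubleStarGraph s)) (hω : 200 ≤ G.cliqueNum)
    (L0 : Set V) (k : ℕ) (L : Fin k → Set V) (hT : IsOptimalTemplate G s L0 L)
    (hval : 28 * G.cliqueNum ^ (s+6) ≤ templateValue G s L0 L) :
    ∀ v ∈ templateNbhd G L0 L,
      TemplatePendant G s L v ∨ TemplateDense G s L v ∨ TemplatePure G s L v := by
  classical
  intro v hv
  by_cases hnp : TemplatePendant G s L v
  · exact Or.inl hnp
  by_cases hnd : TemplateDense G s L v
  · exact Or.inr (Or.inl hnd)
  refine Or.inr (Or.inr ?_)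
  obtain ⟨h1, h2, h3, h4, h5, h6⟩ := id hT.1
  have hlarge := tt_large hω hT
  have p2 : 0 < G.cliqueNum ^ (s+2) := by positivity
  have hdn : ∀ j, ∀ u ∈ L j, ∃ i, i ≠ j ∧
      G.cliqueNum ^ (s+2) ≤ 14 * ({w ∈ L i | G.Adj u w ∧ ¬ G.Adj v w}).ncard := by
    intro j u hu
    by_contra hc
    push Not at hc
    exact hnd ⟨j, u, hu, hc⟩
  have hstep : ∀ j, ∀ u ∈ L j, ¬ G.Adj v u → ∃ i, i ≠ j ∧ ∀ w ∈ L i, ¬ G.Adj v w := by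
    intro j u hu hvu
    obtain ⟨i, hij, hc⟩ := hdn j u hu
    refine ⟨i, hij, fun w hw hvw => ?_⟩
    have := tt_key hω hT hnp hnd hij hu hvu hw hvw
    omega
  have hne : ∀ i, (L i).Nonempty := by
    intro i
    rw [← Set.ncard_pos]
    exact lt_of_lt_of_le (by positivity) (h5 i).1
  obtain ⟨-, j0, u0, hu0, -⟩ := hv
  obtain ⟨j1, -, hc1⟩ := hdn j0 u0 hu0
  have hne1 : ({w ∈ L j1 | G.Adj u0 w ∧ ¬ G.Adj v w}).Nonempty := by
    rw [← Set.ncard_pos]; omega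
  obtain ⟨u1, hu1, -, hvu1⟩ := hne1
  obtain ⟨i1, -, hi1⟩ := hstep j1 u1 hu1 hvu1
  obtain ⟨u2, hu2⟩ := hne i1
  obtain ⟨i2, hi12, hi2⟩ := hstep i1 u2 hu2 (hi1 u2 hu2)
  refine ⟨⟨i1, i2, hi12.symm, hi1, hi2⟩, fun i => ?_⟩
  by_cases hB : ∀ w ∈ L i, ¬ G.Adj v w
  · exact Or.inl hB
  right
  have hii : i ≠ i1 := by rintro rfl; exact hB hi1
  push Not at hB
  obtain ⟨x, hx, hvx⟩ := hB
  obtain ⟨m, hm⟩ : ∃ m, m = (L i1).ncard := ⟨_, rfl⟩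
  have hl := hlarge i1
  have l3 : 2 * G.cliqueNum ^ (s+3) ≤ G.cliqueNum ^ (s+5) := by
    have : G.cliqueNum ^ (s+5) = G.cliqueNum ^ 2 * G.cliqueNum ^ (s+3) := by ring
    rw [this]; exact Nat.mul_le_mul_right _ (by nlinarith)
  have hdc := tt_double_count {w ∈ L i | ¬ G.Adj v w} (L i1) (fun a u => G.Adj a u)
    (m - G.cliqueNum ^ (s+3)) ((G.cliqueNum ^ (s+2)) / 14) ?_ ?_
  · rw [← hm] at hdc hl
    have h14 := Nat.div_mul_le_self (G.cliqueNum ^ (s+2)) 14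
    have hmm : m ≤ 2 * (m - G.cliqueNum ^ (s+3)) := by omega
    have hmpos : 0 < m := by
      have : 0 < G.cliqueNum ^ (s+3) := by positivity
      omega
    set a := ({w ∈ L i | ¬ G.Adj v w}).ncard
    refine Nat.le_of_mul_le_mul_right (c := m) ?_ hmpos
    calc 7 * a * m ≤ 7 * a * (2 * (m - G.cliqueNum ^ (s+3))) := Nat.mul_le_mul_left _ hmm
      _ = 14 * (a * (m - G.cliqueNum ^ (s+3))) := by ring
      _ ≤ 14 * (m * (G.cliqueNum ^ (s+2) / 14)) := Nat.mul_le_mul_left _ hdc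
      _ = (G.cliqueNum ^ (s+2) / 14 * 14) * m := by ring
      _ ≤ _ := Nat.mul_le_mul_right _ h14
  · intro a ha
    have hb := h6 i i1 hii a ha.1
    have hsub : L i1 ⊆ {b ∈ L i1 | G.Adj a b} ∪ {b ∈ L i1 | ¬ G.Adj a b} := by
      intro w hw
      by_cases h : G.Adj a w
      · exact Or.inl ⟨hw, h⟩
      · exact Or.inr ⟨hw, h⟩
    have := (Set.ncard_le_ncard hsub).trans (Set.ncard_union_le _ _)
    omega
  · intro u hu
    have := tt_key hω hT hnp hnd hii hu (hi1 u hu) hx hvx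
    have hsub : {a ∈ {w ∈ L i | ¬ G.Adj v w} | G.Adj a u} ⊆
        {w ∈ L i | G.Adj u w ∧ ¬ G.Adj v w} := fun z hz => ⟨hz.1.1, hz.2.symm, hz.1.2⟩
    have := Set.ncard_le_ncard hsub
    omega
end

section
/- Let s ≥ 1 be an integer, let G be an H_s-free graph with clique number ω satisfying ω ≥ 200 and ω³ > ω + s/7, and let 𝓛 = (L_0, L_1, …, L_k) be an optimal s-template in G. Suppose d ≥ 1 and D ≥ 0 are integers such that every H_s-free graph G' with ω(G') < ω is (ω(G')^d, D)-colourable, and let m = (s+1)ω^s. Then the union of the sets M_I over all m-large I ⊆ {1,…,k} induces a (K, D)-colourable subgraph, where K = (ω−1)^d + ω^{s²+4s+2} + ω^{s+3} + 1. -/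
open SimpleGraph Set

open Finset in
/-- Colourability of a finite vertex set, as a working notion. -/
def Col {V : Type*} [DecidableEq V] (G : SimpleGraph V) [DecidableRel G.Adj] (D : ℕ)
    (A : Finset V) (n : ℕ) : Prop :=
  ∃ f : V → ℕ, (∀ v ∈ A, f v < n) ∧ ∀ T : Finset V, T ⊆ A → T.Nonempty →
    (∀ x ∈ T, ∀ y ∈ T, f x = f y) → ∃ v ∈ T, (T.filter (fun u => G.Adj v u)).card ≤ D

section ColLemmas
variable {V : Type*} [DecidableEq V] {G : SimpleGraph V} [DecidableRel G.Adj] {D : ℕ}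

lemma Col.mono {A B : Finset V} {n m : ℕ} (h : Col G D A n) (hBA : B ⊆ A) (hnm : n ≤ m) :
    Col G D B m := by
  obtain ⟨f, h1, h2⟩ := h
  exact ⟨f, fun v hv => (h1 v (hBA hv)).trans_le hnm, fun T hT => h2 T (hT.trans hBA)⟩

lemma Col.union {A B : Finset V} {n m : ℕ} (hA : Col G D A n) (hB : Col G D B m) :
    Col G D (A ∪ B) (n + m) := by
  obtain ⟨f, h1, h2⟩ := hA
  obtain ⟨g, g1, g2⟩ := hB
  refine ⟨fun v => if v ∈ A then f v else n + g v, ?_, ?_⟩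
  · intro v hv
    by_cases h : v ∈ A
    · simp only [h, if_true]; have := h1 v h; omega
    · have hb : v ∈ B := by simpa [h] using hv
      simp only [h, if_false]; have := g1 v hb; omega
  · intro T hT hne hmono
    obtain ⟨t, ht⟩ := hne
    by_cases h : t ∈ A
    · have hTA : T ⊆ A := by
        intro x hx
        by_contra hxA
        have := hmono t ht x hx
        simp only [h, hxA, if_true, if_false] at this
        have := h1 t h; omega
      refine h2 T hTA ⟨t, ht⟩ fun x hx y hy => ?_
      have := hmono x hx y hy
      simpa [hTA hx, hTA hy] using this
    · have hTA : ∀ x ∈ T, x ∉ A := by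
        intro x hx hxA
        have := hmono t ht x hx
        simp only [h, hxA, if_true, if_false] at this
        have := h1 x hxA; omega
      have hTB : T ⊆ B := fun x hx => by
        have := hT hx
        simpa [hTA x hx] using this
      refine g2 T hTB ⟨t, ht⟩ fun x hx y hy => ?_
      have := hmono x hx y hy
      simpa [hTA x hx, hTA y hy] using this

lemma Col.union_anti {A B : Finset V} {n : ℕ} (hA : Col G D A n) (hB : Col G D B n)
    (hAB : ∀ x ∈ A, ∀ y ∈ B, ¬ G.Adj x y) :
    Col G D (A ∪ B) n := by
  obtain ⟨f, h1, h2⟩ := hA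
  obtain ⟨g, g1, g2⟩ := hB
  refine ⟨fun v => if v ∈ A then f v else g v, ?_, ?_⟩
  · intro v hv
    by_cases h : v ∈ A
    · simp only [h, if_true]; exact h1 v h
    · have hb : v ∈ B := by simpa [h] using hv
      simp only [h, if_false]; exact g1 v hb
  · intro T hT hne hmono
    by_cases hTA : (T ∩ A).Nonempty
    · obtain ⟨v, hv, hc⟩ := h2 (T ∩ A) Finset.inter_subset_right hTA (fun x hx y hy => by
        have hx' := Finset.mem_inter.1 hx
        have hy' := Finset.mem_inter.1 hy
        have := hmono x hx'.1 y hy'.1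
        simpa [hx'.2, hy'.2] using this)
      have hv' := Finset.mem_inter.1 hv
      refine ⟨v, hv'.1, le_trans (Finset.card_le_card ?_) hc⟩
      intro u hu
      simp only [Finset.mem_filter, Finset.mem_inter] at hu ⊢
      refine ⟨⟨hu.1, ?_⟩, hu.2⟩
      by_contra huA
      have : u ∈ B := by simpa [huA] using hT hu.1
      exact hAB v hv'.2 u this hu.2
    · have hTA' : ∀ x ∈ T, x ∉ A := fun x hx hxA => hTA ⟨x, Finset.mem_inter.2 ⟨hx, hxA⟩⟩
      have hTB : T ⊆ B := fun x hx => by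
        have := hT hx
        simpa [hTA' x hx] using this
      refine g2 T hTB hne fun x hx y hy => ?_
      have := hmono x hx y hy
      simpa [hTA' x hx, hTA' y hy] using this

lemma col_empty (n : ℕ) : Col G D (∅ : Finset V) n :=
  ⟨fun _ => 0, by simp, fun T hT hne => by
    rw [Finset.subset_empty.1 hT] at hne; simp at hne⟩

lemma col_singleton (v : V) : Col G D {v} 1 := by
  refine ⟨fun _ => 0, by simp, fun T hT hne _ => ?_⟩
  obtain ⟨t, ht⟩ := hne
  refine ⟨t, ht, ?_⟩
  rw [Finset.filter_eq_empty_iff.2]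
  · simp
  · intro x hx hadj
    have h1 := Finset.mem_singleton.1 (hT hx)
    have h2 := Finset.mem_singleton.1 (hT ht)
    subst h1; subst h2
    exact G.irrefl hadj

lemma col_card (A : Finset V) : Col G D A A.card := by
  induction A using Finset.induction_on with
  | empty => exact col_empty _
  | insert a A ha ih =>
    rw [Finset.card_insert_of_notMem ha, Finset.insert_eq, add_comm]
    exact (col_singleton a).union ih

lemma col_biUnion {ι : Type*} [DecidableEq ι] (S : Finset ι) (A : ι → Finset V) (n : ℕ)
    (h : ∀ i ∈ S, Col G D (A i) n) : Col G D (S.biUnion A) (S.card * n) := by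
  induction S using Finset.induction_on with
  | empty => simpa using col_empty _
  | insert a S ha ih =>
    rw [Finset.card_insert_of_notMem ha, Finset.biUnion_insert, add_mul, one_mul, add_comm]
    exact (h a (by simp)).union (ih fun i hi => h i (by simp [hi]))

lemma col_maxdeg (A : Finset V) (n : ℕ)
    (h : ∀ v ∈ A, (A.filter (fun u => G.Adj v u)).card < n) : Col G D A n := by
  have key : ∀ B : Finset V, B ⊆ A →
      ∃ f : V → ℕ, (∀ v ∈ B, f v < n) ∧ ∀ x ∈ B, ∀ y ∈ B, G.Adj x y → f x ≠ f y := by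
    intro B
    induction B using Finset.induction_on with
    | empty => intro _; exact ⟨fun _ => 0, by simp, by simp⟩
    | insert a B ha ih =>
      intro hB
      obtain ⟨f, h1, h2⟩ := ih (fun x hx => hB (by simp [hx]))
      have haA : a ∈ A := hB (by simp)
      have hcard : ((B.filter (fun u => G.Adj a u)).image f).card < (Finset.range n).card := by
        rw [Finset.card_range]
        refine lt_of_le_of_lt (Finset.card_image_le.trans (Finset.card_le_card ?_)) (h a haA)
        exact Finset.filter_subset_filter _ (fun x hx => hB (by simp [hx]))
      obtain ⟨c, hc, hc'⟩ := Finset.exists_mem_notMem_of_card_lt_card hcard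
      have hc'' : ∀ u ∈ B, G.Adj a u → f u ≠ c := by
        intro u hu hau e
        exact hc' (Finset.mem_image.2 ⟨u, by simp [hu, hau], e⟩)
      have hne : ∀ u ∈ B, u ≠ a := fun u hu e => ha (e ▸ hu)
      refine ⟨Function.update f a c, ?_, ?_⟩
      · intro v hv
        rcases Finset.mem_insert.1 hv with rfl | hv
        · simpa using hc
        · simpa [Function.update_of_ne (hne v hv)] using h1 v hv
      · intro x hx y hy hxy
        rcases Finset.mem_insert.1 hx with hx1 | hx1 <;>
          rcases Finset.mem_insert.1 hy with hy1 | hy1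
        · subst hx1; subst hy1; exact absurd hxy G.irrefl
        · subst hx1
          rw [Function.update_self, Function.update_of_ne (hne y hy1)]
          exact (hc'' y hy1 hxy).symm
        · subst hy1
          rw [Function.update_self, Function.update_of_ne (hne x hx1)]
          exact hc'' x hx1 hxy.symm
        · rw [Function.update_of_ne (hne x hx1), Function.update_of_ne (hne y hy1)]
          exact h2 x hx1 y hy1 hxy
  obtain ⟨f, h1, h2⟩ := key A subset_rfl
  refine ⟨f, h1, fun T hT hne hmono => ?_⟩
  obtain ⟨t, ht⟩ := hne
  refine ⟨t, ht, ?_⟩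
  rw [Finset.filter_eq_empty_iff.2]
  · simp
  · intro x hx hadj
    exact h2 t (hT ht) x (hT hx) hadj (hmono t ht x hx)

end ColLemmas

lemma inducedFree_iff {V W : Type*} (G : SimpleGraph V) (H : SimpleGraph W) :
    IsInducedFree G H ↔ IsEmpty (H ↪g G) := by
  constructor
  · intro h
    refine ⟨fun φ => h (Set.range φ) ⟨?_⟩⟩
    refine (RelIso.mk (Equiv.ofInjective φ φ.injective) ?_ : H ≃g G.induce (Set.range φ)).symm
    intro a b
    simp
  · rintro h S ⟨e⟩
    exact h.false (e.symm.toEmbedding.trans (SimpleGraph.Embedding.induce S))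

lemma doubleStar_embed {V : Type*} [DecidableEq V] (G : SimpleGraph V) (s : ℕ) (hs : 1 ≤ s)
    (hfree : IsInducedFree G (doubleStarGraph s)) (p q : V) (S T : Finset V)
    (hS : S.card = s) (hT : T.card = s) (hpq : G.Adj p q)
    (hSp : ∀ x ∈ S, G.Adj p x) (hSq : ∀ x ∈ S, ¬ G.Adj q x)
    (hTq : ∀ x ∈ T, G.Adj q x) (hTp : ∀ x ∈ T, ¬ G.Adj p x)
    (hSS : ∀ x ∈ S, ∀ y ∈ S, ¬ G.Adj x y) (hTT : ∀ x ∈ T, ∀ y ∈ T, ¬ G.Adj x y)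
    (hST : ∀ x ∈ S, ∀ y ∈ T, ¬ G.Adj x y) : False := by
  rw [inducedFree_iff] at hfree
  have eS : Nonempty (Fin s ≃ S) := ⟨(S.equivFinOfCardEq hS).symm⟩
  have eT : Nonempty (Fin s ≃ T) := ⟨(T.equivFinOfCardEq hT).symm⟩
  obtain ⟨eS⟩ := eS
  obtain ⟨eT⟩ := eT
  obtain ⟨a0, ha0⟩ : S.Nonempty := Finset.card_pos.1 (by omega)
  obtain ⟨b0, hb0⟩ : T.Nonempty := Finset.card_pos.1 (by omega)
  have hpT : p ∉ T := fun h => hST a0 ha0 p h (hSp a0 ha0).symm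
  have hqS : q ∉ S := fun h => hST q h b0 hb0 (hTq b0 hb0)
  have hpS : p ∉ S := fun h => G.irrefl (hSp p h)
  have hqT : q ∉ T := fun h => G.irrefl (hTq q h)
  have hdis : ∀ x ∈ S, x ∉ T := fun x hx hx' => hTp x hx' (hSp x hx)
  let f : Fin (2*s+2) → V := fun a =>
    if h0 : (a:ℕ) = 0 then p else if h1 : (a:ℕ) = 1 then q else
    if h2 : (a:ℕ) ≤ s+1 then eS ⟨a - 2, by omega⟩ else eT ⟨a - (s+2), by omega⟩
  have f0 : ∀ a : Fin (2*s+2), (a:ℕ) = 0 → f a = p := fun a h => by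
    simp only [f, dif_pos h]
  have f1 : ∀ a : Fin (2*s+2), (a:ℕ) = 1 → f a = q := fun a h => by
    have e0 : (a:ℕ) ≠ 0 := by omega
    simp only [f, dif_neg e0, dif_pos h]
  have f2 : ∀ a : Fin (2*s+2), 2 ≤ (a:ℕ) → (a:ℕ) ≤ s+1 → ∃ h, f a = eS ⟨a-2, h⟩ := fun a h h' => by
    refine ⟨by omega, ?_⟩
    have e0 : (a:ℕ) ≠ 0 := by omega
    have e1 : (a:ℕ) ≠ 1 := by omega
    simp only [f, dif_neg e0, dif_neg e1, dif_pos h']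
  have f3 : ∀ a : Fin (2*s+2), s+2 ≤ (a:ℕ) → ∃ h, f a = eT ⟨a-(s+2), h⟩ := fun a h => by
    refine ⟨by omega, ?_⟩
    have e0 : (a:ℕ) ≠ 0 := by omega
    have e1 : (a:ℕ) ≠ 1 := by omega
    have e2 : ¬ (a:ℕ) ≤ s+1 := by omega
    simp only [f, dif_neg e0, dif_neg e1, dif_neg e2]
  have m2 : ∀ a : Fin (2*s+2), 2 ≤ (a:ℕ) → (a:ℕ) ≤ s+1 → f a ∈ S := fun a h h' => by
    obtain ⟨_, e⟩ := f2 a h h'; rw [e]; exact (eS _).2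
  have m3 : ∀ a : Fin (2*s+2), s+2 ≤ (a:ℕ) → f a ∈ T := fun a h => by
    obtain ⟨_, e⟩ := f3 a h; rw [e]; exact (eT _).2
  have cases4 : ∀ a : Fin (2*s+2), (a:ℕ) = 0 ∨ (a:ℕ) = 1 ∨ (2 ≤ (a:ℕ) ∧ (a:ℕ) ≤ s+1) ∨
      s+2 ≤ (a:ℕ) := fun a => by omega
  have hpq' := hpq.ne
  have finj : Function.Injective f := by
    intro a b hab
    apply Fin.ext
    rcases cases4 a with ha | ha | ha | ha <;> rcases cases4 b with hb | hb | hb | hb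
    · omega
    · rw [f0 a ha, f1 b hb] at hab; exact absurd hab hpq'
    · rw [f0 a ha] at hab; exact absurd (m2 b hb.1 hb.2) (hab ▸ hpS)
    · rw [f0 a ha] at hab; exact absurd (m3 b hb) (hab ▸ hpT)
    · rw [f1 a ha, f0 b hb] at hab; exact absurd hab.symm hpq'
    · omega
    · rw [f1 a ha] at hab; exact absurd (m2 b hb.1 hb.2) (hab ▸ hqS)
    · rw [f1 a ha] at hab; exact absurd (m3 b hb) (hab ▸ hqT)
    · rw [f0 b hb] at hab; exact absurd (m2 a ha.1 ha.2) (hab ▸ hpS)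
    · rw [f1 b hb] at hab; exact absurd (m2 a ha.1 ha.2) (hab ▸ hqS)
    · obtain ⟨_, e⟩ := f2 a ha.1 ha.2
      obtain ⟨_, e'⟩ := f2 b hb.1 hb.2
      rw [e, e'] at hab
      have := eS.injective (Subtype.ext hab)
      simp only [Fin.mk.injEq] at this
      omega
    · exact absurd (m3 b hb) (hab ▸ hdis _ (m2 a ha.1 ha.2))
    · rw [f0 b hb] at hab; exact absurd (m3 a ha) (hab ▸ hpT)
    · rw [f1 b hb] at hab; exact absurd (m3 a ha) (hab ▸ hqT)
    · exact absurd (m3 a ha) (hab ▸ hdis _ (m2 b hb.1 hb.2))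
    · obtain ⟨_, e⟩ := f3 a ha
      obtain ⟨_, e'⟩ := f3 b hb
      rw [e, e'] at hab
      have := eT.injective (Subtype.ext hab)
      simp only [Fin.mk.injEq] at this
      omega
  refine hfree.false ⟨⟨f, finj⟩, ?_⟩
  intro a b
  simp only [Function.Embedding.coeFn_mk, doubleStarGraph, SimpleGraph.fromRel_adj, ne_eq,
    ← Fin.val_inj]
  rcases cases4 a with ha | ha | ha | ha <;> rcases cases4 b with hb | hb | hb | hb
  · rw [f0 a ha, f0 b hb]; simp only [SimpleGraph.irrefl, false_iff]; omega
  · rw [f0 a ha, f1 b hb]; simp only [hpq, true_iff]; omega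
  · rw [f0 a ha]; simp only [hSp _ (m2 b hb.1 hb.2), true_iff]; omega
  · rw [f0 a ha]; simp only [hTp _ (m3 b hb), false_iff]; omega
  · rw [f1 a ha, f0 b hb]; simp only [hpq.symm, true_iff]; omega
  · rw [f1 a ha, f1 b hb]; simp only [SimpleGraph.irrefl, false_iff]; omega
  · rw [f1 a ha]; simp only [hSq _ (m2 b hb.1 hb.2), false_iff]; omega
  · rw [f1 a ha]; simp only [hTq _ (m3 b hb), true_iff]; omega
  · rw [f0 b hb]; simp only [(hSp _ (m2 a ha.1 ha.2)).symm, true_iff]; omega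
  · rw [f1 b hb, G.adj_comm]; simp only [hSq _ (m2 a ha.1 ha.2), false_iff]; omega
  · simp only [hSS _ (m2 a ha.1 ha.2) _ (m2 b hb.1 hb.2), false_iff]; omega
  · simp only [hST _ (m2 a ha.1 ha.2) _ (m3 b hb), false_iff]; omega
  · rw [f0 b hb, G.adj_comm]; simp only [hTp _ (m3 a ha), false_iff]; omega
  · rw [f1 b hb]; simp only [(hTq _ (m3 a ha)).symm, true_iff]; omega
  · rw [G.adj_comm]; simp only [hST _ (m2 b hb.1 hb.2) _ (m3 a ha), false_iff]; omega
  · simp only [hTT _ (m3 a ha) _ (m3 b hb), false_iff]; omega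

lemma ramsey_aux {V : Type*} [DecidableEq V] (G : SimpleGraph V) [DecidableRel G.Adj] :
    ∀ n a t : ℕ, a + t = n → ∀ T : Finset V,
      (∀ Q : Finset V, Q ⊆ T → G.IsClique (Q : Set V) → Q.card ≤ a) →
      (a + t).choose a ≤ T.card →
      ∃ S : Finset V, S ⊆ T ∧ S.card = t + 1 ∧ ∀ x ∈ S, ∀ y ∈ S, ¬ G.Adj x y := by
  intro n
  induction n with
  | zero =>
    intro a t h T hQ hT
    have ha : a = 0 := by omega
    subst ha
    have : T.Nonempty := Finset.card_pos.1 (by simpa using hT)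
    obtain ⟨v, hv⟩ := this
    have := hQ {v} (by simpa using hv) (by simp)
    simp at this
  | succ n ih =>
    intro a t h T hQ hT
    have hne : T.Nonempty := Finset.card_pos.1 (lt_of_lt_of_le (Nat.choose_pos (by omega)) hT)
    obtain ⟨v, hv⟩ := hne
    rcases t with _ | t
    · exact ⟨{v}, by simpa using hv, by simp, by simp⟩
    rcases a with _ | a
    · have := hQ {v} (by simpa using hv) (by simp)
      simp at this
    have hch : (a + 1 + (t + 1)).choose (a + 1) =
        (a + (t + 1)).choose a + (a + 1 + t).choose (a + 1) := by
      have : a + 1 + (t + 1) = (a + (t + 1)) + 1 := by ring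
      rw [this, Nat.choose_succ_succ]
      congr 2; omega
    have hsplit : ((T.erase v).filter (fun u => G.Adj v u)).card +
        ((T.erase v).filter (fun u => ¬ G.Adj v u)).card = T.card - 1 := by
      rw [Finset.card_filter_add_card_filter_not, Finset.card_erase_of_mem hv]
    have hTpos : 0 < T.card := Finset.card_pos.2 ⟨v, hv⟩
    by_cases hb : (a + (t + 1)).choose a ≤ ((T.erase v).filter (fun u => G.Adj v u)).card
    · obtain ⟨S, hS, h1, h2⟩ := ih a (t+1) (by omega) _ (by
        intro Q hQs hQc
        have hv' : v ∉ Q := fun hh => by simpa using hQs hh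
        have := hQ (insert v Q) (by
          intro x hx
          rcases Finset.mem_insert.1 hx with rfl | hx
          · exact hv
          · have := hQs hx; simp at this; exact this.1.2) (by
          rw [Finset.coe_insert]
          refine hQc.insert fun b hb _ => ?_
          have := hQs hb; simp at this; exact this.2)
        rw [Finset.card_insert_of_notMem hv'] at this
        omega) hb
      refine ⟨S, fun x hx => ?_, h1, h2⟩
      have := hS hx; simp at this; exact this.1.2
    · obtain ⟨S, hS, h1, h2⟩ := ih (a+1) t (by omega)
        ((T.erase v).filter (fun u => ¬ G.Adj v u)) (by
          intro Q hQs hQc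
          refine hQ Q (fun x hx => ?_) hQc
          have := hQs hx; simp at this; exact this.1.2) (by omega)
      have hv' : v ∉ S := fun hh => by simpa using hS hh
      refine ⟨insert v S, fun x hx => ?_, by rw [Finset.card_insert_of_notMem hv', h1], ?_⟩
      · rcases Finset.mem_insert.1 hx with rfl | hx
        · exact hv
        · have := hS hx; simp at this; exact this.1.2
      · intro x hx y hy
        rcases Finset.mem_insert.1 hx with hx1 | hx1 <;>
          rcases Finset.mem_insert.1 hy with hy1 | hy1
        · subst hx1; subst hy1; exact G.irrefl
        · subst hx1; have := hS hy1; simp at this; exact this.2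
        · subst hy1; have := hS hx1; simp at this; rw [G.adj_comm]; exact this.2
        · exact h2 x hx1 y hy1

lemma choose_bound (w : ℕ) (hw : 2 ≤ w) (t : ℕ) : (w + t).choose w ≤ w ^ (t + 1) := by
  induction t with
  | zero => simp; omega
  | succ t ih =>
    rcases t with _ | t
    · simp; nlinarith
    · have h1 : (w + (t + 1) + 1).choose w * (t + 2) = (w + (t+1)).choose w * (w + t + 2) := by
        have := Nat.add_one_mul_choose_eq (w + (t+1)) (t+1)
        have e1 : (w + (t + 1) + 1).choose w = (w + (t+1)).succ.choose (t+1).succ := by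
          rw [← Nat.choose_symm_of_eq_add]; simp; ring
        have e2 : (w + (t+1)).choose w = (w + (t+1)).choose (t+1) := by
          rw [← Nat.choose_symm_of_eq_add]; ring
        rw [e1, e2]
        simp only [Nat.succ_eq_add_one] at this ⊢
        linarith
      have h2 : w + t + 2 ≤ w * (t + 2) := by nlinarith
      have h3 : (w + (t + 1) + 1).choose w * (t + 2) ≤ (w ^ (t + 1 + 1) * w) * (t + 2) := by
        rw [h1]
        calc _ ≤ w ^ (t + 1 + 1) * (w * (t+2)) := Nat.mul_le_mul ih h2
          _ = _ := by ring
      have := Nat.le_of_mul_le_mul_right h3 (by omega)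
      rw [← pow_succ] at this
      exact this

lemma ramsey {V : Type*} [DecidableEq V] (G : SimpleGraph V) [DecidableRel G.Adj]
    (w s : ℕ) (hw : 2 ≤ w) (hs : 1 ≤ s) (T : Finset V)
    (hQ : ∀ Q : Finset V, G.IsClique (Q : Set V) → Q.card ≤ w) (hT : w ^ s ≤ T.card) :
    ∃ S : Finset V, S ⊆ T ∧ S.card = s ∧ ∀ x ∈ S, ∀ y ∈ S, ¬ G.Adj x y := by
  obtain ⟨t, rfl⟩ : ∃ t, s = t + 1 := ⟨s - 1, by omega⟩
  exact ramsey_aux G _ w t rfl T (fun Q _ => hQ Q) ((choose_bound w hw t).trans hT)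

lemma laminar_card {k : ℕ} (F : Finset (Finset (Fin k))) (h2 : ∀ C ∈ F, 2 ≤ C.card)
    (hl : ∀ C ∈ F, ∀ C' ∈ F, C ⊆ C' ∨ C' ⊆ C ∨ Disjoint C C') : F.card ≤ k := by
  rcases F.eq_empty_or_nonempty with rfl | ⟨C0, hC0⟩
  · simp
  have hFk : Nonempty (Fin k) := by
    obtain ⟨x, _⟩ : C0.Nonempty := Finset.card_pos.1 (by have := h2 C0 hC0; omega)
    exact ⟨x⟩
  have key : ∀ C ∈ F, ∃ y m : Fin k, ∃ D : Finset (Fin k), m ∈ C ∧ (∀ z ∈ C, m ≤ z) ∧ m ∈ D ∧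
      D ⊆ C ∧ (∀ E ∈ F, E ⊆ C → E ≠ C → m ∈ E → E ⊆ D) ∧
      (∀ E ∈ F, m ∉ E → ¬ E ⊆ D → Disjoint E D) ∧
      y ∈ C ∧ y ∉ D ∧ ∀ z ∈ C, z ∉ D → y ≤ z := by
    intro C hC
    have hne : C.Nonempty := Finset.card_pos.1 (by have := h2 C hC; omega)
    set m := C.min' hne with hm
    have hmC : m ∈ C := C.min'_mem hne
    have hD : ∃ D : Finset (Fin k), m ∈ D ∧ D ⊆ C ∧ D ≠ C ∧
        (∀ E ∈ F, E ⊆ C → E ≠ C → m ∈ E → E ⊆ D) ∧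
        (∀ E ∈ F, m ∉ E → ¬ E ⊆ D → Disjoint E D) := by
      by_cases hex : (F.filter (fun E => E ⊆ C ∧ E ≠ C ∧ m ∈ E)).Nonempty
      · obtain ⟨D, hD, hmax⟩ := Finset.exists_max_image _ Finset.card hex
        simp only [Finset.mem_filter] at hD hmax
        refine ⟨D, hD.2.2.2, hD.2.1, hD.2.2.1, ?_, ?_⟩
        · intro E hE h1 h2 h3
          rcases hl E hE D hD.1 with h | h | h
          · exact h
          · exact (Finset.eq_of_subset_of_card_le h (hmax E ⟨hE, h1, h2, h3⟩)).symm.subset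
          · exact absurd hD.2.2.2 (Finset.disjoint_left.1 h h3)
        · intro E hE h1 h2
          rcases hl E hE D hD.1 with h | h | h
          · exact absurd h h2
          · exact absurd (h hD.2.2.2) h1
          · exact h
      · refine ⟨{m}, by simp, by simpa using hmC, ?_, ?_, ?_⟩
        · intro e
          have := h2 C hC
          rw [← e] at this; simp at this
        · intro E hE h1 h2 h3
          exact absurd ⟨E, by simp [hE, h1, h2, h3]⟩ hex
        · intro E hE h1 _
          simpa using h1
    obtain ⟨D, d1, d2, d3, d4, d5⟩ := hD
    have hne2 : (C \ D).Nonempty := by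
      rw [Finset.sdiff_nonempty]
      exact fun h => d3 (d2.antisymm h)
    refine ⟨(C \ D).min' hne2, m, D, hmC, fun z hz => C.min'_le z hz, d1, d2, d4, d5, ?_, ?_, ?_⟩
    · exact (Finset.mem_sdiff.1 ((C \ D).min'_mem hne2)).1
    · exact (Finset.mem_sdiff.1 ((C \ D).min'_mem hne2)).2
    · intro z hz hz'
      exact (C \ D).min'_le z (Finset.mem_sdiff.2 ⟨hz, hz'⟩)
  choose! y m D p1 p2 p3 p4 p5 p6 p7 p8 p9 using key
  have aux : ∀ C ∈ F, ∀ C' ∈ F, C ⊆ C' → C ≠ C' → y C ≠ y C' := by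
    intro C hC C' hC' hsub hne e
    have hmC : m C' ∉ C := by
      intro hm
      exact p8 C' hC' (p5 C' hC' C hC hsub hne hm (e ▸ p7 C hC))
    have hdis : Disjoint C (D C') := p6 C' hC' C hC hmC (fun h => p8 C' hC' (h (e ▸ p7 C hC)))
    have h1 : y C' ≤ m C := p9 C' hC' _ (hsub (p1 C hC)) (Finset.disjoint_left.1 hdis (p1 C hC))
    have h2 : m C ≤ y C := p2 C hC _ (p7 C hC)
    have h3 : y C = m C := le_antisymm (e ▸ h1) h2
    exact p8 C hC (h3 ▸ p3 C hC)
  have hinj : Set.InjOn y (F : Set (Finset (Fin k))) := by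
    intro C hC C' hC' e
    by_contra hne
    rcases hl C hC C' hC' with h | h | h
    · exact aux C hC C' hC' h hne e
    · exact aux C' hC' C hC h (Ne.symm hne) e.symm
    · exact Finset.disjoint_left.1 h (p7 C hC) (e ▸ p7 C' hC')
  calc F.card ≤ (Finset.univ : Finset (Fin k)).card :=
        Finset.card_le_card_of_injOn y (fun _ _ => Finset.mem_univ _) hinj
    _ = k := by simp

lemma pow_sum_bound (d x y : ℕ) (hx : 1 ≤ x) (hy : 1 ≤ y) :
    x ^ d + y ^ d ≤ (x + y - 1) ^ d + 1 := by
  obtain ⟨x, rfl⟩ : ∃ t, x = t + 1 := ⟨x - 1, by omega⟩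
  obtain ⟨y, rfl⟩ : ∃ t, y = t + 1 := ⟨y - 1, by omega⟩
  have e : x + 1 + (y + 1) - 1 = x + y + 1 := by omega
  rw [e]
  induction d with
  | zero => simp
  | succ d ih =>
    have h1 : 1 ≤ (x+1)^d := Nat.one_le_pow _ _ (by omega)
    have h2 : 1 ≤ (y+1)^d := Nat.one_le_pow _ _ (by omega)
    rw [pow_succ, pow_succ, pow_succ]
    nlinarith [Nat.mul_le_mul_left y h1, Nat.mul_le_mul_left x h2,
      Nat.mul_le_mul_right (x + y + 1) ih]

lemma sum_pow_le {ι : Type*} [DecidableEq ι] (A : Finset ι) (a : ι → ℕ) (d : ℕ) (hd : 1 ≤ d) :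
    ∑ i ∈ A, a i ^ d ≤ (∑ i ∈ A, a i) ^ d := by
  induction A using Finset.induction_on with
  | empty => simp
  | insert i A hi ih =>
    rw [Finset.sum_insert hi, Finset.sum_insert hi]
    exact (Nat.add_le_add_left ih _).trans (pow_add_pow_le (Nat.zero_le _) (Nat.zero_le _) (by omega))

lemma antichain_sum {ι : Type*} [DecidableEq ι] (A : Finset ι) (a : ι → ℕ) (d w : ℕ) (hd : 1 ≤ d)
    (hw : ∀ i ∈ A, a i ≤ w - 1) (hsum : ∑ i ∈ A, a i ≤ w) :
    ∑ i ∈ A, a i ^ d ≤ (w - 1) ^ d + 1 := by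
  by_cases h : ∃ i ∈ A, 1 ≤ a i
  · obtain ⟨i, hi, hai⟩ := h
    rw [← Finset.add_sum_erase A _ hi] at hsum ⊢
    have h1 := sum_pow_le (A.erase i) a d hd
    set r := ∑ j ∈ A.erase i, a j
    have h2 : a i ^ d ≤ (w-1)^d := Nat.pow_le_pow_left (hw i hi) d
    rcases Nat.eq_zero_or_pos r with hr | hr
    · rw [hr, zero_pow (by omega)] at h1
      omega
    · have h3 := pow_sum_bound d (a i) r hai hr
      have h4 : (a i + r - 1) ^ d ≤ (w-1)^d := Nat.pow_le_pow_left (by omega) d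
      omega
  · push Not at h
    have : ∑ i ∈ A, a i ^ d = 0 := Finset.sum_eq_zero fun i hi => by
      have := h i hi
      have : a i = 0 := by omega
      rw [this, zero_pow (by omega)]
    omega

/-- The abstract data extracted from a template and its pure vertices. -/
structure Setup {V : Type*} [DecidableEq V] (G : SimpleGraph V) [DecidableRel G.Adj]
    (s w k : ℕ) (L : Fin k → Finset V) (M : Finset (Fin k) → Finset V) : Prop where
  hs : 1 ≤ s
  hfree : IsInducedFree G (doubleStarGraph s)
  hw : 200 ≤ w
  hw3 : 7 * w + s < 7 * w ^ 3
  hcl : ∀ Q : Finset V, G.IsClique (Q : Set V) → Q.card ≤ w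
  hLcard : ∀ i, w ^ (s+5) ≤ (L i).card
  hLnon : ∀ i j, i ≠ j → ∀ v ∈ L i, ((L j).filter (fun u => ¬ G.Adj v u)).card ≤ w ^ (s+3)
  hMadj : ∀ I, ∀ v ∈ M I, ∀ i ∈ I, 7 * ((L i).filter (fun u => ¬ G.Adj v u)).card ≤ w ^ (s+2)
  hMnon : ∀ I, ∀ v ∈ M I, ∀ i ∉ I, ∀ u ∈ L i, ¬ G.Adj v u
  hMtwo : ∀ I, ∀ v ∈ M I, ∃ i₁ i₂, i₁ ≠ i₂ ∧ i₁ ∉ I ∧ i₂ ∉ I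
  hMne : ∀ I, ∀ v ∈ M I, ∃ i, i ∈ I

namespace Setup
section
variable {V : Type*} [DecidableEq V] {G : SimpleGraph V} [DecidableRel G.Adj]
    {s w k : ℕ} {L : Fin k → Finset V} {M : Finset (Fin k) → Finset V}

lemma stable (h : Setup G s w k L M) (T : Finset V) (hT : w ^ s ≤ T.card) :
    ∃ S : Finset V, S ⊆ T ∧ S.card = s ∧ ∀ x ∈ S, ∀ y ∈ S, ¬ G.Adj x y :=
  ramsey G w s (by have := h.hw; omega) h.hs T h.hcl hT

lemma card_nonadj_biUnion (A S : Finset V) (c m : ℕ)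
    (hA : ∀ x ∈ S, m * (A.filter (fun u => ¬ G.Adj x u)).card ≤ c) :
    m * (A.filter (fun u => ∃ x ∈ S, ¬ G.Adj x u)).card ≤ S.card * c := by
  have h1 : A.filter (fun u => ∃ x ∈ S, ¬ G.Adj x u) ⊆
      S.biUnion (fun x => A.filter (fun u => ¬ G.Adj x u)) := by
    intro u hu
    simp only [Finset.mem_filter, Finset.mem_biUnion] at hu ⊢
    obtain ⟨hu, x, hx, hxu⟩ := hu
    exact ⟨x, hx, hu, hxu⟩
  calc _ ≤ m * ∑ x ∈ S, (A.filter (fun u => ¬ G.Adj x u)).card :=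
        Nat.mul_le_mul_left _ ((Finset.card_le_card h1).trans Finset.card_biUnion_le)
    _ = ∑ x ∈ S, m * (A.filter (fun u => ¬ G.Adj x u)).card := Finset.mul_sum _ _ _
    _ ≤ ∑ _x ∈ S, c := Finset.sum_le_sum hA
    _ = _ := by simp

lemma wpow (h : Setup G s w k L M) : 0 < w ^ s := pow_pos (by have := h.hw; omega) _

lemma kw (h : Setup G s w k L M) : k ≤ w := by
  have hw := h.hw
  have key : ∀ F : Finset (Fin k), F.card ≤ w + 1 → ∃ Q : Finset V, G.IsClique (Q : Set V) ∧
      Q.card = F.card ∧ ∀ q ∈ Q, ∃ j ∈ F, q ∈ L j := by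
    intro F
    induction F using Finset.induction_on with
    | empty => intro _; exact ⟨∅, by simp, by simp, by simp⟩
    | insert i F hi ih =>
      intro hF
      rw [Finset.card_insert_of_notMem hi] at hF
      obtain ⟨Q, hQ, hQc, hQL⟩ := ih (by omega)
      have hb := card_nonadj_biUnion (G := G) (L i) Q (w ^ (s+3)) 1 (by
        intro x hx
        obtain ⟨j, hj, hxj⟩ := hQL x hx
        rw [one_mul]
        exact h.hLnon j i (fun e => hi (e ▸ hj)) x hxj)
      have hlt : ((L i).filter (fun u => ∃ x ∈ Q, ¬ G.Adj x u)).card < (L i).card := by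
        refine lt_of_lt_of_le ?_ (h.hLcard i)
        have : Q.card * w ^ (s+3) < w ^ (s+5) := by
          have e : w ^ (s+5) = (w * w) * w^(s+3) := by ring
          rw [e]
          refine Nat.mul_lt_mul_of_pos_right ?_ (pow_pos (by omega) _)
          nlinarith
        omega
      obtain ⟨u, hu, hu'⟩ := Finset.exists_mem_notMem_of_card_lt_card hlt
      have hadj : ∀ x ∈ Q, G.Adj x u := by
        intro x hx
        by_contra hn
        exact hu' (Finset.mem_filter.2 ⟨hu, x, hx, hn⟩)
      have huQ : u ∉ Q := fun hh => G.irrefl (hadj u hh)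
      refine ⟨insert u Q, ?_, ?_, ?_⟩
      · rw [Finset.coe_insert]
        exact hQ.insert fun b hb _ => (hadj b hb).symm
      · rw [Finset.card_insert_of_notMem huQ, Finset.card_insert_of_notMem hi, hQc]
      · intro q hq
        rcases Finset.mem_insert.1 hq with hq | hq
        · exact ⟨i, by simp, hq ▸ hu⟩
        · obtain ⟨j, hj, hqj⟩ := hQL q hq
          exact ⟨j, by simp [hj], hqj⟩
  by_contra hk
  obtain ⟨F, _, hF⟩ := Finset.exists_subset_card_eq (s := (Finset.univ : Finset (Fin k)))
    (n := w + 1) (by simp; omega)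
  obtain ⟨Q, hQ, hQc, _⟩ := key F hF.le
  have := h.hcl Q hQ
  omega

lemma clique_lt (h : Setup G s w k L M) (I : Finset (Fin k)) (Q : Finset V) (hQM : Q ⊆ M I)
    (hQ : G.IsClique (Q : Set V)) : Q.card ≤ w - 1 := by
  have hw := h.hw
  rcases Q.eq_empty_or_nonempty with rfl | ⟨q, hq⟩
  · simp
  obtain ⟨i, hi⟩ := h.hMne I q (hQM hq)
  have hb := card_nonadj_biUnion (G := G) (L i) Q (w ^ (s+2)) 7
    (fun x hx => h.hMadj I x (hQM hx) i hi)
  have hlt : ((L i).filter (fun u => ∃ x ∈ Q, ¬ G.Adj x u)).card < (L i).card := by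
    refine lt_of_lt_of_le ?_ (h.hLcard i)
    have : Q.card * w ^ (s+2) < w ^ (s+5) := by
      have e : w ^ (s+5) = (w * w * w) * w^(s+2) := by ring
      rw [e]
      refine Nat.mul_lt_mul_of_pos_right ?_ (pow_pos (by omega) _)
      have := h.hcl Q hQ
      nlinarith
    omega
  obtain ⟨u, hu, hu'⟩ := Finset.exists_mem_notMem_of_card_lt_card hlt
  have hadj : ∀ x ∈ Q, G.Adj x u := by
    intro x hx
    by_contra hn
    exact hu' (Finset.mem_filter.2 ⟨hu, x, hx, hn⟩)
  have huQ : u ∉ Q := fun hh => G.irrefl (hadj u hh)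
  have := h.hcl (insert u Q) (by
    rw [Finset.coe_insert]
    exact hQ.insert fun b hb _ => (hadj b hb).symm)
  rw [Finset.card_insert_of_notMem huQ] at this
  omega

lemma exists_nbr (h : Setup G s w k L M) {I : Finset (Fin k)} {i : Fin k} (hi : i ∈ I)
    (S : Finset V) (hS : S ⊆ M I) (hSc : S.card ≤ s) (B : Finset V) (hB : B.card ≤ w ^ (s+3)) :
    ∃ u ∈ L i, u ∉ B ∧ ∀ x ∈ S, G.Adj x u := by
  have hw := h.hw
  have hb := card_nonadj_biUnion (G := G) (L i) S (w ^ (s+2)) 7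
    (fun x hx => h.hMadj I x (hS hx) i hi)
  have hlt : ((L i).filter (fun u => ∃ x ∈ S, ¬ G.Adj x u) ∪ B).card < (L i).card := by
    refine lt_of_lt_of_le ?_ (h.hLcard i)
    have h1 := Finset.card_union_le ((L i).filter (fun u => ∃ x ∈ S, ¬ G.Adj x u)) B
    have h2 : (7 * w + s) * w ^ (s+2) < (7 * w ^ 3) * w^(s+2) :=
      Nat.mul_lt_mul_of_pos_right h.hw3 (pow_pos (by omega) _)
    have h3 : S.card * w ^ (s+2) ≤ s * w ^ (s+2) := Nat.mul_le_mul_right _ hSc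
    have e1 : (7 * w + s) * w ^ (s+2) = 7 * w ^ (s+3) + s * w^(s+2) := by ring
    have e2 : (7 * w ^ 3) * w^(s+2) = 7 * w ^ (s+5) := by ring
    omega
  obtain ⟨u, hu, hu'⟩ := Finset.exists_mem_notMem_of_card_lt_card hlt
  rw [Finset.mem_union, not_or] at hu'
  refine ⟨u, hu, hu'.2, fun x hx => ?_⟩
  by_contra hn
  exact hu'.1 (Finset.mem_filter.2 ⟨hu, x, hx, hn⟩)

lemma big_sub (h : Setup G s w k L M) (i : Fin k) (v : V)
    (hv : ((L i).filter (fun u => ¬ G.Adj v u)).card ≤ w ^ (s+3)) :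
    ∃ S : Finset V, S ⊆ L i ∧ S.card = s ∧ (∀ x ∈ S, ∀ y ∈ S, ¬ G.Adj x y) ∧
      ∀ x ∈ S, G.Adj v x := by
  have hw := h.hw
  obtain ⟨S, h1, h2, h3⟩ := h.stable ((L i).filter (fun u => G.Adj v u)) (by
    have e := Finset.card_filter_add_card_filter_not (s := L i) (fun u => G.Adj v u)
    have := h.hLcard i
    have : w ^ s + w ^ (s+3) ≤ w ^ (s+5) := by
      have e1 : w ^ (s+3) = w^3 * w ^ s := by ring
      have e2 : w ^ (s+5) = w^3 * (w * w) * w ^ s := by ring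
      have h3 : 0 < w ^ 3 := pow_pos (by omega) _
      rw [e1, e2]
      have : 1 + w ^ 3 ≤ w ^ 3 * (w * w) := by
        have h4 : 2 ≤ w * w := by nlinarith
        have := Nat.mul_le_mul_left (w ^ 3) h4
        omega
      nlinarith [Nat.mul_le_mul_right (w ^ s) this]
    omega)
  refine ⟨S, fun x hx => (Finset.mem_filter.1 (h1 hx)).1, h2, h3,
    fun x hx => (Finset.mem_filter.1 (h1 hx)).2⟩

/-- Lemma A: few neighbours in the parts missing both `i` and `j`. -/
lemma few_nbrs (h : Setup G s w k L M) {I : Finset (Fin k)} {v : V} (hv : v ∈ M I)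
    {i j : Fin k} (hi : i ∈ I) (hj : j ∉ I) (T : Finset V)
    (hT : ∀ x ∈ T, G.Adj v x ∧ ∃ J, x ∈ M J ∧ i ∉ J ∧ j ∉ J) : T.card < w ^ s := by
  by_contra hc
  push Not at hc
  have hij : i ≠ j := fun e => hj (e ▸ hi)
  obtain ⟨u, hu, _, hvu⟩ := h.exists_nbr hi {v} (by simpa using hv) (by simpa using h.hs) ∅ (by simp)
  have hvu := hvu v (by simp)
  obtain ⟨S, s1, s2, s3, s4⟩ := h.big_sub j u (h.hLnon i j hij u hu)
  obtain ⟨T', t1, t2, t3⟩ := h.stable T hc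
  refine doubleStar_embed G s h.hs h.hfree u v S T' s2 t2 hvu.symm s4 ?_ ?_ ?_ s3 t3 ?_
  · intro x hx; exact h.hMnon I v hv j hj x (s1 hx)
  · intro x hx; exact (hT x (t1 hx)).1
  · intro x hx hux
    obtain ⟨_, J, hxJ, hiJ, _⟩ := hT x (t1 hx)
    exact h.hMnon J x hxJ i hiJ u hu hux.symm
  · intro x hx y hy hxy
    obtain ⟨_, J, hyJ, _, hjJ⟩ := hT y (t1 hy)
    exact h.hMnon J y hyJ j hjJ x (s1 hx) hxy.symm

/-- Lemma B: incomparable classes are crowded. -/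
lemma crowded (h : Setup G s w k L M) {I J : Finset (Fin k)} {i j : Fin k}
    (hi : i ∈ I) (hi' : i ∉ J) (hj : j ∈ J) (hj' : j ∉ I) (S T : Finset V)
    (hSM : S ⊆ M I) (hTM : T ⊆ M J) (hS : S.card = s) (hT : T.card = s)
    (hSS : ∀ x ∈ S, ∀ y ∈ S, ¬ G.Adj x y) (hTT : ∀ x ∈ T, ∀ y ∈ T, ¬ G.Adj x y)
    (hST : ∀ x ∈ S, ∀ y ∈ T, ¬ G.Adj x y) : False := by
  have hij : i ≠ j := fun e => hj' (e ▸ hi)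
  obtain ⟨u, hu, _, huS⟩ := h.exists_nbr hi S hSM hS.le ∅ (by simp)
  obtain ⟨u', hu', hn, huT⟩ := h.exists_nbr hj T hTM hT.le
    ((L j).filter (fun x => ¬ G.Adj u x)) (h.hLnon i j hij u hu)
  have huu : G.Adj u u' := by
    by_contra hh
    exact hn (Finset.mem_filter.2 ⟨hu', hh⟩)
  refine doubleStar_embed G s h.hs h.hfree u u' S T hS hT huu (fun x hx => (huS x hx).symm) ?_
    (fun x hx => (huT x hx).symm) ?_ hSS hTT hST
  · intro x hx hux
    exact h.hMnon I x (hSM hx) j hj' u' hu' hux.symm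
  · intro x hx hux
    exact h.hMnon J x (hTM hx) i hi' u hu hux.symm

/-- Lemma C: large incomparable sets have full union. -/
lemma union_univ (h : Setup G s w k L M) {I J : Finset (Fin k)}
    (hI : (s+1) * w ^ s < (M I).card) (hJ : (s+1) * w ^ s < (M J).card)
    (hIJ : ¬ I ⊆ J) (hJI : ¬ J ⊆ I) (c : Fin k) : c ∈ I ∨ c ∈ J := by
  by_contra hc
  push Not at hc
  obtain ⟨i, hi, hi'⟩ := Finset.not_subset.1 hIJ
  obtain ⟨j, hj, hj'⟩ := Finset.not_subset.1 hJI
  obtain ⟨T, t1, t2, t3⟩ := h.stable (M J) (by nlinarith [h.wpow])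
  have hb : ((M I).filter (fun u => ∃ x ∈ T, G.Adj x u)).card ≤ s * w ^ s := by
    have h1 : (M I).filter (fun u => ∃ x ∈ T, G.Adj x u) ⊆
        T.biUnion (fun x => (M I).filter (fun u => G.Adj x u)) := by
      intro u hu
      simp only [Finset.mem_filter, Finset.mem_biUnion] at hu ⊢
      obtain ⟨hu, x, hx, hxu⟩ := hu
      exact ⟨x, hx, hu, hxu⟩
    refine (Finset.card_le_card h1).trans ?_
    rw [← t2]
    refine Finset.card_biUnion_le_card_mul _ _ _ (fun x hx => ?_)
    rw [t2]
    refine (h.few_nbrs (t1 hx) hj hc.2 _ ?_).le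
    intro y hy
    rw [Finset.mem_filter] at hy
    exact ⟨hy.2, I, hy.1, hj', hc.1⟩
  obtain ⟨S, s1, s2, s3⟩ := h.stable ((M I).filter (fun u => ¬ ∃ x ∈ T, G.Adj x u)) (by
    have e := Finset.card_filter_add_card_filter_not (s := M I) (fun u => ∃ x ∈ T, G.Adj x u)
    have : (s+1) * w ^ s = s * w ^ s + w ^ s := by ring
    omega)
  refine h.crowded hi hi' hj hj' S T (fun x hx => (Finset.mem_filter.1 (s1 hx)).1) t1 s2 t2 s3 t3 ?_
  intro x hx y hy hxy
  exact (Finset.mem_filter.1 (s1 hx)).2 ⟨y, hy, hxy.symm⟩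

/-- Lemma D: a vertex with a neighbour in a larger class has bounded degree. -/
lemma few_nbrs_up (h : Setup G s w k L M) {I J : Finset (Fin k)} {v x : V} (hv : v ∈ M I)
    (hx : x ∈ M J) (hvx : G.Adj v x) {j c : Fin k} (hj : j ∈ J) (hj' : j ∉ I) (hc : c ∉ J)
    (T : Finset V) (hT : ∀ y ∈ T, G.Adj v y ∧ ∃ I', y ∈ M I' ∧ j ∉ I' ∧ c ∉ I') :
    T.card < 2 * w ^ s := by
  have h1 : (T.filter (fun y => G.Adj x y)).card < w ^ s := by
    refine h.few_nbrs hx hj hc _ ?_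
    intro y hy
    rw [Finset.mem_filter] at hy
    exact ⟨hy.2, (hT y hy.1).2⟩
  have h2 : (T.filter (fun y => ¬ G.Adj x y)).card < w ^ s := by
    by_contra hcon
    push Not at hcon
    obtain ⟨S, s1, s2, s3, s4⟩ := h.big_sub j x (by
      have := h.hMadj J x hx j hj
      have : w ^ (s+2) ≤ w ^ (s+3) := Nat.pow_le_pow_right (by have := h.hw; omega) (by omega)
      omega)
    obtain ⟨T', t1, t2, t3⟩ := h.stable _ hcon
    refine doubleStar_embed G s h.hs h.hfree x v S T' s2 t2 hvx.symm s4 ?_ ?_ ?_ s3 t3 ?_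
    · intro z hz; exact h.hMnon I v hv j hj' z (s1 hz)
    · intro z hz; exact (hT z (Finset.mem_filter.1 (t1 hz)).1).1
    · intro z hz; exact (Finset.mem_filter.1 (t1 hz)).2
    · intro y hy z hz hyz
      obtain ⟨_, I', hzI, hjI, _⟩ := hT z (Finset.mem_filter.1 (t1 hz)).1
      exact h.hMnon I' z hzI j hjI y (s1 hy) hyz.symm
  have e := Finset.card_filter_add_card_filter_not (s := T) (fun y => G.Adj x y)
  omega

/-- The vertices of `M J` with many non-neighbours in a fixed small subset of `M I` are few. -/
lemma bad_card (h : Setup G s w k L M) {I J : Finset (Fin k)} {i j : Fin k}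
    (hi : i ∈ I) (hi' : i ∉ J) (hj : j ∈ J) (hj' : j ∉ I) (U : Finset V) (hU : U ⊆ M I)
    (n : ℕ) (hUn : U.card ≤ n) :
    ((M J).filter (fun b => w ^ s ≤ (U.filter (fun u => ¬ G.Adj b u)).card)).card
      ≤ w ^ s * n ^ s := by
  set B := (M J).filter (fun b => w ^ s ≤ (U.filter (fun u => ¬ G.Adj b u)).card) with hB
  have hex : ∀ b ∈ B, ∃ S : Finset V, S ⊆ U ∧ S.card = s ∧ (∀ x ∈ S, ∀ y ∈ S, ¬ G.Adj x y) ∧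
      ∀ x ∈ S, ¬ G.Adj b x := by
    intro b hb
    rw [hB, Finset.mem_filter] at hb
    obtain ⟨S, s1, s2, s3⟩ := h.stable _ hb.2
    exact ⟨S, fun x hx => (Finset.mem_filter.1 (s1 hx)).1, s2, s3,
      fun x hx => (Finset.mem_filter.1 (s1 hx)).2⟩
  choose! f f1 f2 f3 f4 using hex
  have hmap : ∀ b ∈ B, f b ∈ U.powersetCard s := fun b hb =>
    Finset.mem_powersetCard.2 ⟨f1 b hb, f2 b hb⟩
  have := Finset.card_le_mul_card_image_of_maps_to hmap (w ^ s) (by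
    intro S _
    by_contra hcon
    push Not at hcon
    obtain ⟨T, t1, t2, t3⟩ := h.stable _ hcon.le
    obtain ⟨b, hb⟩ : T.Nonempty := Finset.card_pos.1 (by have := h.hs; omega)
    have tm : ∀ b ∈ T, b ∈ B ∧ f b = S := fun b hb => by simpa using t1 hb
    obtain ⟨hbB, hbS⟩ := tm b hb
    refine h.crowded hi hi' hj hj' S T ?_ ?_ (hbS ▸ f2 b hbB) t2 (hbS ▸ f3 b hbB) t3 ?_
    · intro x hx; exact hU (f1 b hbB (hbS ▸ hx))
    · intro x hx; exact (Finset.mem_filter.1 (tm x hx).1).1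
    · intro x hx y hy hxy
      exact f4 y (tm y hy).1 x ((tm y hy).2 ▸ hx) hxy.symm)
  refine this.trans (Nat.mul_le_mul_left _ ?_)
  rw [Finset.card_powersetCard]
  exact (Nat.choose_le_pow _ _).trans (Nat.pow_le_pow_left hUn s)

end
end Setup

lemma packing {V : Type*} [DecidableEq V] (G : SimpleGraph V) (B : Finset V) (N w : ℕ)
    (hN : 1 ≤ N) (hcl : ∀ Q : Finset V, G.IsClique (Q : Set V) → Q.card ≤ w) :
    ∃ a : ℕ, ∃ K : Fin N → Finset V, (∀ i, K i ⊆ B ∧ G.IsClique (K i : Set V) ∧ (K i).card = a) ∧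
      (∀ i j, i ≠ j → Disjoint (K i) (K j)) ∧
      ∃ R : Finset V, R.card ≤ N * w ∧
        ∀ Q : Finset V, Q ⊆ B \ R → G.IsClique (Q : Set V) → Q.card ≤ a := by
  classical
  let P : ℕ → ℕ → Prop := fun n a => ∃ K : Fin n → Finset V,
    (∀ i, K i ⊆ B ∧ G.IsClique (K i : Set V) ∧ (K i).card = a) ∧
    (∀ i j, i ≠ j → Disjoint (K i) (K j))
  have hP0 : P N 0 := ⟨fun _ => ∅, by simp, by simp⟩
  set a := Nat.findGreatest (P N) w with ha
  have hPa : P N a := Nat.findGreatest_spec (m := 0) (Nat.zero_le _) hP0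
  have hPa1 : ¬ P N (a + 1) := by
    intro hp
    have hle : a + 1 ≤ w := by
      obtain ⟨K, h1, _⟩ := hp
      obtain ⟨_, h2, h3⟩ := h1 ⟨0, by omega⟩
      rw [← h3]; exact hcl _ h2
    have := Nat.le_findGreatest hle hp
    omega
  have hQ0 : P 0 (a+1) := ⟨fun i => i.elim0, fun i => i.elim0, fun i => i.elim0⟩
  set n := Nat.findGreatest (fun n => P n (a+1)) N with hn
  have hPn : P n (a+1) := Nat.findGreatest_spec (P := fun n => P n (a+1)) (m := 0) (Nat.zero_le _) hQ0
  have hnN : n ≤ N := Nat.findGreatest_le _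
  have hnN' : n ≠ N := fun e => hPa1 (e ▸ hPn)
  have hPn1 : ¬ P (n + 1) (a + 1) := by
    intro hp
    have := Nat.le_findGreatest (P := fun n => P n (a+1)) (n := N) (by omega) hp
    omega
  obtain ⟨K, hK1, hK2⟩ := hPa
  refine ⟨a, K, hK1, hK2, ?_⟩
  obtain ⟨K', h1, h2⟩ := hPn
  refine ⟨Finset.univ.biUnion K', ?_, ?_⟩
  · have hb := Finset.card_biUnion_le_card_mul (Finset.univ) K' w
      (fun i _ => hcl _ (h1 i).2.1)
    rw [Finset.card_univ, Fintype.card_fin] at hb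
    exact hb.trans (Nat.mul_le_mul_right _ hnN)
  · intro Q hQ hQc
    by_contra hcon
    push Not at hcon
    obtain ⟨Q', hQ', hQ'c⟩ := Finset.exists_subset_card_eq (s := Q) (n := a + 1) hcon
    apply hPn1
    have hdis : ∀ i, Disjoint Q' (K' i) := by
      intro i
      rw [Finset.disjoint_left]
      intro x hx hx'
      have := Finset.mem_sdiff.1 (hQ (hQ' hx))
      exact this.2 (Finset.mem_biUnion.2 ⟨i, Finset.mem_univ _, hx'⟩)
    refine ⟨Fin.cons Q' K', ?_, ?_⟩
    · intro i
      refine Fin.cases ?_ (fun i => ?_) i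
      · rw [Fin.cons_zero]
        exact ⟨fun x hx => (Finset.mem_sdiff.1 (hQ (hQ' hx))).1,
          hQc.subset (by exact_mod_cast hQ'), hQ'c⟩
      · rw [Fin.cons_succ]; exact h1 i
    · intro i j
      refine Fin.cases ?_ (fun i => ?_) i <;> refine Fin.cases ?_ (fun j => ?_) j
      · intro hh; exact absurd rfl hh
      · intro _; rw [Fin.cons_zero, Fin.cons_succ]; exact hdis j
      · intro _; rw [Fin.cons_zero, Fin.cons_succ]; exact (hdis i).symm
      · intro hh; rw [Fin.cons_succ, Fin.cons_succ]
        exact h2 i j (fun e => hh (by rw [e]))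

/-- A family of index sets with pairwise full unions. -/
def FullUnions {k : ℕ} (A : Finset (Finset (Fin k))) : Prop :=
  ∀ I ∈ A, ∀ J ∈ A, I ≠ J → ∀ c, c ∈ I ∨ c ∈ J

lemma Setup.build {V : Type*} [DecidableEq V] {G : SimpleGraph V} [DecidableRel G.Adj]
    {s w k : ℕ} {L : Fin k → Finset V} {M : Finset (Fin k) → Finset V}
    (h : Setup G s w k L M) (F : Finset (Finset (Fin k))) (hF : ∀ I ∈ F, ∃ c, c ∉ I) :
    ∃ (a : Finset (Fin k) → ℕ) (U : Finset (Fin k) → Finset V) (Del : Finset V),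
      Del.card ≤ F.card * w ^ (s+2) + F.card * F.card * (w ^ s * (w ^ (s+2)) ^ s) ∧
      (∀ I ∈ F, U I ⊆ M I ∧ (U I).card ≤ w ^ (s+2) ∧ a I ≤ w - 1 ∧
        ∀ Q : Finset V, Q ⊆ M I \ Del → G.IsClique (Q : Set V) → Q.card ≤ a I) ∧
      ∀ A ⊆ F, FullUnions A → ∀ Q : Finset V, G.IsClique (Q : Set V) →
        (∀ q ∈ Q, ∀ I ∈ A, ((U I).filter (fun u => ¬ G.Adj q u)).card < w ^ s) →
        Q.card + ∑ I ∈ A, a I ≤ w := by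
  have hw := h.hw
  induction F using Finset.induction_on with
  | empty =>
    refine ⟨fun _ => 0, fun _ => ∅, ∅, by simp, by simp, ?_⟩
    intro A hA _ Q hQ _
    simpa using h.hcl Q hQ
  | insert J F hJF ih =>
    obtain ⟨a, U, Del, hDel, hI, hA⟩ := ih (fun I hI => hF I (by simp [hI]))
    let bad : Finset (Fin k) → Finset V := fun I => (M J).filter (fun b =>
      (∀ c, c ∈ I ∨ c ∈ J) ∧ w ^ s ≤ ((U I).filter (fun u => ¬ G.Adj b u)).card)
    obtain ⟨cJ, hcJ⟩ := hF J (by simp)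
    have hbad : ∀ I ∈ F, (bad I).card ≤ w ^ s * (w ^ (s+2)) ^ s := by
      intro I hIF
      by_cases hfull : ∀ c, c ∈ I ∨ c ∈ J
      · obtain ⟨cI, hcI⟩ := hF I (by simp [hIF])
        refine le_trans (Finset.card_le_card ?_) (h.bad_card (i := cJ) (j := cI)
          ((hfull cJ).resolve_right hcJ) hcJ
          ((hfull cI).resolve_left hcI) hcI (U I) (hI I hIF).1 _ (hI I hIF).2.1)
        intro x hx
        simp only [bad, Finset.mem_filter] at hx ⊢
        exact ⟨hx.1, hx.2.2⟩
      · have : bad I = ∅ := by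
          simp only [bad]
          rw [Finset.filter_eq_empty_iff]
          intro x _ hh
          exact hfull hh.1
        rw [this]; simp
    set B := M J \ F.biUnion bad with hB
    have hBM : B ⊆ M J := Finset.sdiff_subset
    have hgood : ∀ b ∈ B, ∀ I ∈ F, (∀ c, c ∈ I ∨ c ∈ J) →
        ((U I).filter (fun u => ¬ G.Adj b u)).card < w ^ s := by
      intro b hb I hIF hfull
      rw [hB, Finset.mem_sdiff] at hb
      by_contra hcon
      push Not at hcon
      exact hb.2 (Finset.mem_biUnion.2 ⟨I, hIF, Finset.mem_filter.2 ⟨hb.1, hfull, hcon⟩⟩)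
    have hNpos : 1 ≤ w ^ (s+1) := Nat.one_le_pow _ _ (by omega)
    obtain ⟨a0, K, hK1, hK2, R, hR, hQR⟩ := packing G B (w ^ (s+1)) w hNpos h.hcl
    have hNw : w ^ (s+1) * w = w ^ (s+2) := by ring
    have ha0w : a0 ≤ w - 1 := by
      obtain ⟨k1, k2, k3⟩ := hK1 ⟨0, hNpos⟩
      rw [← k3]
      exact h.clique_lt J _ (k1.trans hBM) k2
    set U0 := Finset.univ.biUnion K with hU0
    have hneJ : ∀ I ∈ F, I ≠ J := fun I hI e => hJF (e ▸ hI)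
    refine ⟨Function.update a J a0, Function.update U J U0, Del ∪ F.biUnion bad ∪ R, ?_, ?_, ?_⟩
    · rw [Finset.card_insert_of_notMem hJF]
      have c1 := Finset.card_union_le (Del ∪ F.biUnion bad) R
      have c2 := Finset.card_union_le Del (F.biUnion bad)
      have c3 := Finset.card_biUnion_le_card_mul F bad _ hbad
      rw [hNw] at hR
      set E := w ^ s * (w ^ (s+2)) ^ s
      set n := F.card
      nlinarith [Nat.zero_le (n * E), Nat.zero_le E]
    · intro I hIF
      rcases Finset.mem_insert.1 hIF with rfl | hIF
      · rw [Function.update_self, Function.update_self]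
        refine ⟨?_, ?_, ha0w, ?_⟩
        · intro x hx
          obtain ⟨m, _, hm⟩ := Finset.mem_biUnion.1 hx
          exact hBM ((hK1 m).1 hm)
        · have hb := Finset.card_biUnion_le_card_mul (Finset.univ) K w
            (fun i _ => h.hcl _ (hK1 i).2.1)
          rw [Finset.card_univ, Fintype.card_fin, hNw] at hb
          exact hb
        · intro Q hQ hQc
          refine hQR Q ?_ hQc
          intro x hx
          have := hQ hx
          simp only [Finset.mem_sdiff, Finset.mem_union, not_or] at this
          simp only [hB, Finset.mem_sdiff]
          exact ⟨⟨this.1, this.2.1.2⟩, this.2.2⟩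
      · rw [Function.update_of_ne (hneJ I hIF), Function.update_of_ne (hneJ I hIF)]
        obtain ⟨p1, p2, p3, p4⟩ := hI I hIF
        refine ⟨p1, p2, p3, fun Q hQ => p4 Q (hQ.trans ?_)⟩
        intro x hx
        simp only [Finset.mem_sdiff, Finset.mem_union, not_or] at hx ⊢
        exact ⟨hx.1, hx.2.1.1⟩
    · intro A hAF hfull Q hQ hgQ
      by_cases hJA : J ∈ A
      · -- choose a clique of the packing complete to `Q`
        have hAF' : A.erase J ⊆ F := by
          intro I hI
          rw [Finset.mem_erase] at hI
          exact (Finset.mem_insert.1 (hAF hI.2)).resolve_left hI.1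
        have hQU : ((U0).filter (fun u => ∃ x ∈ Q, ¬ G.Adj x u)).card < w ^ (s+1) := by
          have := Setup.card_nonadj_biUnion (G := G) U0 Q (w ^ s - 1) 1 (by
            intro x hx
            have := hgQ x hx J hJA
            rw [Function.update_self] at this
            omega)
          have hQw := h.hcl Q hQ
          have h1 : Q.card * (w ^ s - 1) ≤ w * (w ^ s - 1) := Nat.mul_le_mul_right _ hQw
          have h2 : w * (w ^ s - 1) < w * w ^ s :=
            Nat.mul_lt_mul_of_pos_left (by have := h.wpow; omega) (by omega)
          have h3 : w * w ^ s = w ^ (s+1) := by ring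
          omega
        have hex : ∃ m, ∀ u ∈ K m, ∀ x ∈ Q, G.Adj x u := by
          by_contra hcon
          push Not at hcon
          choose g g1 g2 using hcon
          have hginj : Function.Injective g := by
            intro m m' e
            by_contra hne
            exact Finset.disjoint_left.1 (hK2 m m' hne) (g1 m) (e ▸ g1 m')
          have := Finset.card_le_card_of_injOn (s := (Finset.univ : Finset (Fin (w ^ (s+1)))))
            (t := (U0).filter (fun u => ∃ x ∈ Q, ¬ G.Adj x u)) g (by
              intro m _
              have : g m ∈ U0.filter (fun u => ∃ x ∈ Q, ¬ G.Adj x u) :=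
                Finset.mem_filter.2 ⟨Finset.mem_biUnion.2 ⟨m, Finset.mem_univ _, g1 m⟩, g2 m⟩
              exact_mod_cast this) hginj.injOn
          rw [Finset.card_univ, Fintype.card_fin] at this
          omega
        obtain ⟨m, hm⟩ := hex
        obtain ⟨k1, k2, k3⟩ := hK1 m
        have hdisj : Disjoint Q (K m) := by
          rw [Finset.disjoint_left]
          intro x hx hx'
          exact G.irrefl (hm x hx' x hx)
        have hfinal := hA (A.erase J) hAF' (fun I hI I' hI' => hfull I (Finset.mem_of_mem_erase hI)
          I' (Finset.mem_of_mem_erase hI')) (Q ∪ K m) (by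
            intro x hx y hy hxy
            simp only [Finset.coe_union, Set.mem_union, Finset.mem_coe] at hx hy
            rcases hx with hx | hx <;> rcases hy with hy | hy
            · exact hQ hx hy hxy
            · exact hm y hy x hx
            · exact (hm x hx y hy).symm
            · exact k2 hx hy hxy) (by
            intro q hq I hI'
            have hIe := Finset.mem_erase.1 hI'
            rcases Finset.mem_union.1 hq with hq | hq
            · have := hgQ q hq I hIe.2
              rwa [Function.update_of_ne hIe.1] at this
            · exact hgood q (k1 hq) I (hAF' hI') (hfull I hIe.2 J hJA hIe.1))
        rw [Finset.card_union_of_disjoint hdisj, k3] at hfinal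
        rw [← Finset.add_sum_erase A _ hJA, Function.update_self]
        have : ∑ I ∈ A.erase J, Function.update a J a0 I = ∑ I ∈ A.erase J, a I :=
          Finset.sum_congr rfl fun I hI => Function.update_of_ne (Finset.ne_of_mem_erase hI) _ _
        rw [this]
        omega
      · have hne : ∀ I ∈ A, I ≠ J := fun I hI e => hJA (e ▸ hI)
        have : ∑ I ∈ A, Function.update a J a0 I = ∑ I ∈ A, a I :=
          Finset.sum_congr rfl fun I hI => Function.update_of_ne (hne I hI) _ _
        rw [this]
        refine hA A (fun I hI => (Finset.mem_insert.1 (hAF hI)).resolve_left (hne I hI)) hfull Q hQ ?_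
        intro q hq I hI
        have := hgQ q hq I hI
        rwa [Function.update_of_ne (hne I hI)] at this

lemma laminar_col {V : Type*} [DecidableEq V] {G : SimpleGraph V} [DecidableRel G.Adj] {D k : ℕ}
    (Y : Finset (Fin k) → Finset V) (n : Finset (Fin k) → ℕ) (F : Finset (Finset (Fin k)))
    (hl : ∀ I ∈ F, ∀ J ∈ F, I ⊆ J ∨ J ⊆ I ∨ ∀ c, c ∈ I ∨ c ∈ J)
    (hcol : ∀ I ∈ F, Col G D (Y I) (n I))
    (hanti : ∀ I ∈ F, ∀ J ∈ F, I ⊆ J → I ≠ J → ∀ x ∈ Y I, ∀ y ∈ Y J, ¬ G.Adj x y) :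
    ∃ A ⊆ F, FullUnions A ∧ Col G D (F.biUnion Y) (∑ I ∈ A, n I) := by
  induction F using Finset.strongInduction with
  | H F ih =>
  rcases F.eq_empty_or_nonempty with rfl | hne
  · refine ⟨∅, by simp, ?_, by simpa using col_empty _⟩
    intro I hI; simp at hI
  obtain ⟨C, hC, hmin⟩ := Finset.exists_min_image F Finset.card hne
  have ih' : ∀ F' ⊂ F, ∃ A ⊆ F', FullUnions A ∧ Col G D (F'.biUnion Y) (∑ I ∈ A, n I) := by
    intro F' hF'
    have hs := hF'.1
    exact ih F' hF' (fun I hI J hJ => hl I (hs hI) J (hs hJ)) (fun I hI => hcol I (hs hI))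
      (fun I hI J hJ => hanti I (hs hI) J (hs hJ))
  have hF2 : ∀ J ∈ F, ¬ C ⊆ J → ∀ c, c ∈ C ∨ c ∈ J := by
    intro J hJ hCJ
    rcases hl C hC J hJ with h | h | h
    · exact absurd h hCJ
    · exact absurd (Finset.eq_of_subset_of_card_le h (hmin J hJ)).symm.subset hCJ
    · exact h
  by_cases hex : ∃ J ∈ F, ¬ C ⊆ J
  · obtain ⟨J0, hJ0, hCJ0⟩ := hex
    obtain ⟨A1, a1, a2, a3⟩ := ih' (F.filter (fun I => C ⊆ I))
      (Finset.filter_ssubset.2 ⟨J0, hJ0, hCJ0⟩)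
    obtain ⟨A2, b1, b2, b3⟩ := ih' (F.filter (fun I => ¬ C ⊆ I))
      (Finset.filter_ssubset.2 ⟨C, hC, by simp⟩)
    have m1 : ∀ I ∈ A1, I ∈ F ∧ C ⊆ I := fun I hI => Finset.mem_filter.1 (a1 hI)
    have m2 : ∀ I ∈ A2, I ∈ F ∧ ¬ C ⊆ I := fun I hI => Finset.mem_filter.1 (b1 hI)
    refine ⟨A1 ∪ A2, ?_, ?_, ?_⟩
    · intro I hI
      rcases Finset.mem_union.1 hI with h | h
      · exact (m1 I h).1
      · exact (m2 I h).1
    · intro I hI J hJ hIJ c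
      rcases Finset.mem_union.1 hI with h | h <;> rcases Finset.mem_union.1 hJ with h' | h'
      · exact a2 I h J h' hIJ c
      · exact (hF2 J (m2 J h').1 (m2 J h').2 c).imp (fun hc => (m1 I h).2 hc) id
      · exact ((hF2 I (m2 I h).1 (m2 I h).2 c).imp (fun hc => (m1 J h').2 hc) id).symm
      · exact b2 I h J h' hIJ c
    · rw [Finset.sum_union (Finset.disjoint_left.2 fun I h h' => (m2 I h').2 (m1 I h).2)]
      refine (a3.union b3).mono ?_ le_rfl
      intro x hx
      obtain ⟨I, hI, hxI⟩ := Finset.mem_biUnion.1 hx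
      by_cases hCI : C ⊆ I
      · exact Finset.mem_union_left _
          (Finset.mem_biUnion.2 ⟨I, Finset.mem_filter.2 ⟨hI, hCI⟩, hxI⟩)
      · exact Finset.mem_union_right _
          (Finset.mem_biUnion.2 ⟨I, Finset.mem_filter.2 ⟨hI, hCI⟩, hxI⟩)
  · push Not at hex
    obtain ⟨A, a1, a2, a3⟩ := ih' (F.erase C) (Finset.erase_ssubset hC)
    have hun : F.biUnion Y = Y C ∪ (F.erase C).biUnion Y := by
      rw [← Finset.biUnion_insert, Finset.insert_erase hC]
    have hant : ∀ x ∈ Y C, ∀ y ∈ (F.erase C).biUnion Y, ¬ G.Adj x y := by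
      intro x hx y hy
      obtain ⟨J, hJ, hyJ⟩ := Finset.mem_biUnion.1 hy
      rw [Finset.mem_erase] at hJ
      exact hanti C hC J hJ.2 (hex J hJ.2) hJ.1.symm x hx y hyJ
    rw [hun]
    rcases le_total (n C) (∑ I ∈ A, n I) with hle | hle
    · exact ⟨A, a1.trans (Finset.erase_subset _ _), a2,
        ((hcol C hC).mono subset_rfl hle).union_anti a3 hant⟩
    · refine ⟨{C}, by simpa using hC, ?_, ?_⟩
      · intro I hI J hJ hIJ
        simp only [Finset.mem_singleton] at hI hJ
        exact absurd (hI.trans hJ.symm) hIJ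
      · rw [Finset.sum_singleton]
        exact (hcol C hC).union_anti (a3.mono subset_rfl hle) hant

theorem Setup.core {V : Type*} [DecidableEq V] {G : SimpleGraph V} [DecidableRel G.Adj]
    {s w k : ℕ} {L : Fin k → Finset V} {M : Finset (Fin k) → Finset V}
    (h : Setup G s w k L M) (D d : ℕ) (hd : 1 ≤ d)
    (hind : ∀ S : Finset V, ∀ a < w,
      (∀ Q : Finset V, Q ⊆ S → G.IsClique (Q : Set V) → Q.card ≤ a) → Col G D S (a ^ d)) :
    Col G D ((Finset.univ.filter (fun I => (s+1) * w ^ s < (M I).card)).biUnion M)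
      ((w - 1) ^ d + w ^ (s*s + 4*s + 2) + w ^ (s+3) + 1) := by
  classical
  have hw := h.hw
  set F := Finset.univ.filter (fun I => (s+1) * w ^ s < (M I).card) with hF
  have hFm : ∀ I ∈ F, (s+1) * w ^ s < (M I).card := fun I hI => by
    simpa [hF] using hI
  have htwo : ∀ I ∈ F, ∃ i₁ i₂ : Fin k, i₁ ≠ i₂ ∧ i₁ ∉ I ∧ i₂ ∉ I := by
    intro I hI
    obtain ⟨v, hv⟩ : (M I).Nonempty := Finset.card_pos.1 (by have := hFm I hI; omega)
    exact h.hMtwo I v hv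
  have hl : ∀ I ∈ F, ∀ J ∈ F, I ⊆ J ∨ J ⊆ I ∨ ∀ c, c ∈ I ∨ c ∈ J := by
    intro I hI J hJ
    by_cases h1 : I ⊆ J
    · exact Or.inl h1
    by_cases h2 : J ⊆ I
    · exact Or.inr (Or.inl h2)
    exact Or.inr (Or.inr (h.union_univ (hFm I hI) (hFm J hJ) h1 h2))
  have hFk : F.card ≤ k := by
    rw [← Finset.card_image_of_injective F compl_injective]
    refine laminar_card _ ?_ ?_
    · intro C hC
      obtain ⟨I, hI, rfl⟩ := Finset.mem_image.1 hC
      obtain ⟨i₁, i₂, h1, h2, h3⟩ := htwo I hI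
      have : ({i₁, i₂} : Finset (Fin k)) ⊆ Iᶜ := by
        intro x hx
        simp only [Finset.mem_insert, Finset.mem_singleton] at hx
        rcases hx with rfl | rfl <;> simpa
      have := Finset.card_le_card this
      rwa [Finset.card_pair h1] at this
    · intro C hC C' hC'
      obtain ⟨I, hI, rfl⟩ := Finset.mem_image.1 hC
      obtain ⟨J, hJ, rfl⟩ := Finset.mem_image.1 hC'
      rcases hl I hI J hJ with hh | hh | hh
      · exact Or.inr (Or.inl (Finset.compl_subset_compl.2 hh))
      · exact Or.inl (Finset.compl_subset_compl.2 hh)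
      · refine Or.inr (Or.inr (Finset.disjoint_left.2 fun x hx hx' => ?_))
        rw [Finset.mem_compl] at hx hx'
        exact (hh x).elim hx hx'
  have hkw := h.kw
  obtain ⟨a, U, Del, hDel, hI, hA⟩ := h.build F (fun I hI => by
    obtain ⟨i, _, _, hi, _⟩ := htwo I hI
    exact ⟨i, hi⟩)
  let Xp : Fin k × Fin k → Finset V := fun p => (F.biUnion M).filter (fun v =>
    ∃ I, v ∈ M I ∧ p.1 ∉ I ∧ p.2 ∉ I ∧ ∃ J, p.1 ∈ J ∧ p.2 ∉ J ∧ ∃ x ∈ M J, G.Adj v x)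
  set X := (Finset.univ : Finset (Fin k × Fin k)).biUnion Xp with hX
  have hXcol : Col G D X (k * k * (2 * w ^ s)) := by
    have := col_biUnion (G := G) (D := D) (Finset.univ : Finset (Fin k × Fin k)) Xp (2 * w ^ s) (by
      intro p _
      refine col_maxdeg _ _ ?_
      intro v hv
      obtain ⟨_, I, hvI, hj, hc, J, hj', hc', x, hxJ, hvx⟩ := Finset.mem_filter.1 hv
      refine h.few_nbrs_up hvI hxJ hvx hj' hj hc' _ ?_
      intro y hy
      obtain ⟨hyX, hvy⟩ := Finset.mem_filter.1 hy
      obtain ⟨_, I', hyI, hj2, hc2, _⟩ := Finset.mem_filter.1 hyX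
      exact ⟨hvy, I', hyI, hj2, hc2⟩)
    simpa using this
  let Y : Finset (Fin k) → Finset V := fun I => M I \ (X ∪ Del)
  obtain ⟨A, hAF, hAfull, hAcol⟩ := laminar_col (G := G) (D := D) Y (fun I => a I ^ d) F hl (by
    intro I hIF
    obtain ⟨_, _, p3, p4⟩ := hI I hIF
    refine hind _ _ (by omega) fun Q hQ hQc => p4 Q (hQ.trans ?_) hQc
    exact Finset.sdiff_subset_sdiff subset_rfl Finset.subset_union_right) (by
    intro I hIF J hJF hIJ hne x hx y hy hxy
    obtain ⟨hxM, hxX⟩ := Finset.mem_sdiff.1 hx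
    obtain ⟨hyM, _⟩ := Finset.mem_sdiff.1 hy
    have : ¬ J ⊆ I := fun hh => hne (hIJ.antisymm hh)
    obtain ⟨j, hj, hj'⟩ := Finset.not_subset.1 this
    obtain ⟨c, _, _, hc, _⟩ := htwo J hJF
    refine hxX (Finset.mem_union_left _ (Finset.mem_biUnion.2 ⟨(j, c), Finset.mem_univ _, ?_⟩))
    exact Finset.mem_filter.2 ⟨Finset.mem_biUnion.2 ⟨I, hIF, hxM⟩, I, hxM, hj',
      fun hh => hc (hIJ hh), J, hj, hc, y, hyM, hxy⟩)
  have hsum : ∑ I ∈ A, a I ^ d ≤ (w - 1) ^ d + 1 := by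
    refine antichain_sum A a d w hd (fun I hI' => (hI I (hAF hI')).2.2.1) ?_
    simpa using hA A hAF hAfull ∅ (by simp) (by simp)
  refine ((hAcol.union (hXcol.union (col_card Del))).mono ?_ ?_)
  · intro v hv
    obtain ⟨I, hIF, hvI⟩ := Finset.mem_biUnion.1 hv
    simp only [Finset.mem_union]
    by_cases hvX : v ∈ X
    · exact Or.inr (Or.inl hvX)
    by_cases hvD : v ∈ Del
    · exact Or.inr (Or.inr hvD)
    refine Or.inl (Finset.mem_biUnion.2 ⟨I, hIF, Finset.mem_sdiff.2 ⟨hvI, ?_⟩⟩)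
    simp [hvX, hvD]
  · have hFw := hFk.trans hkw
    have e1 : k * k * (2 * w ^ s) ≤ 2 * w ^ (s+2) := by
      calc k * k * (2 * w ^ s) ≤ w * w * (2 * w ^ s) :=
            Nat.mul_le_mul_right _ (Nat.mul_le_mul hkw hkw)
        _ = _ := by ring
    have e2 : F.card * w ^ (s+2) ≤ w ^ (s+3) := by
      calc _ ≤ w * w ^ (s+2) := Nat.mul_le_mul_right _ hFw
        _ = _ := by ring
    have e3 : F.card * F.card * (w ^ s * (w ^ (s+2)) ^ s) ≤ w ^ (s*s+3*s+2) := by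
      calc _ ≤ w * w * (w ^ s * (w ^ (s+2)) ^ s) :=
            Nat.mul_le_mul_right _ (Nat.mul_le_mul hFw hFw)
        _ = _ := by rw [← pow_mul]; ring
    have e4 : 200 * w ^ (s*s+3*s+2) ≤ w ^ (s*s+4*s+2) := by
      have e : w ^ (s*s+4*s+2) = w ^ s * w ^ (s*s+3*s+2) := by ring
      rw [e]
      refine Nat.mul_le_mul_right _ (hw.trans ?_)
      exact Nat.le_self_pow (by have := h.hs; omega) w
    have e5 : w ^ (s+2) ≤ w ^ (s*s+3*s+2) := Nat.pow_le_pow_right (by omega) (by nlinarith)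
    omega

section Bridge

/-- From the working notion to the frozen notion of colourability. -/
lemma Col.toKD {V : Type*} [Fintype V] [DecidableEq V] {G : SimpleGraph V} [DecidableRel G.Adj]
    {D K : ℕ} {A : Finset V} {S : Set V} (h : Col G D A K) (hS : ∀ v ∈ S, v ∈ A) :
    KDColorable (G.induce S) K D := by
  classical
  obtain ⟨f, h1, h2⟩ := h
  refine ⟨fun v => ⟨f v.1, h1 _ (hS _ v.2)⟩, fun i H hH => ?_⟩
  let g : {v : S | (⟨f v.1, h1 _ (hS _ v.2)⟩ : Fin K) = i} → V := fun x => x.1.1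
  have hg : Function.Injective g := fun x y hxy => Subtype.ext (Subtype.ext hxy)
  have hfg : ∀ x, f (g x) = i := fun x => by
    have := x.2
    simp only [Set.mem_setOf_eq] at this
    rw [← this]
  let T : Finset V := (g '' H.verts).toFinset
  have hT : ∀ v, v ∈ T ↔ ∃ x ∈ H.verts, g x = v := by
    intro v; simp only [T, Set.mem_toFinset, Set.mem_image]
  obtain ⟨v, hv, hdeg⟩ := h2 T (by
      intro v hv
      obtain ⟨x, hx, rfl⟩ := (hT v).1 hv
      exact hS _ x.1.2) (by
      obtain ⟨x, hx⟩ := hH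
      exact ⟨g x, (hT _).2 ⟨x, hx, rfl⟩⟩) (by
      intro x hx y hy
      obtain ⟨x, _, rfl⟩ := (hT x).1 hx
      obtain ⟨y, _, rfl⟩ := (hT y).1 hy
      rw [hfg, hfg])
  obtain ⟨x, hx, rfl⟩ := (hT v).1 hv
  refine ⟨x, hx, le_trans ?_ hdeg⟩
  rw [← Set.ncard_image_of_injective _ hg, ← Set.ncard_coe_finset]
  refine Set.ncard_le_ncard ?_ (Finset.finite_toSet _)
  rintro _ ⟨y, hy, rfl⟩
  have hy' : H.Adj x y := hy
  rw [Finset.mem_coe, Finset.mem_filter]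
  exact ⟨(hT _).2 ⟨y, hy'.snd_mem, rfl⟩, hy'.adj_sub⟩

/-- The induction hypothesis in the working notion. -/
lemma ind_to_col {V : Type*} [Fintype V] [DecidableEq V] (G : SimpleGraph V) [DecidableRel G.Adj]
    (s w d D : ℕ) (hfree : IsInducedFree G (doubleStarGraph s))
    (hind : ∀ (W : Type) [Fintype W], ∀ G' : SimpleGraph W,
      IsInducedFree G' (doubleStarGraph s) → G'.cliqueNum < w →
      KDColorable G' (G'.cliqueNum ^ d) D)
    (S : Finset V) (a : ℕ) (ha : a < w)
    (hQ : ∀ Q ⊆ S, G.IsClique (Q : Set V) → Q.card ≤ a) : Col G D S (a ^ d) := by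
  classical
  let e : Fin S.card ↪ V := S.equivFin.symm.toEmbedding.trans (Function.Embedding.subtype _)
  have heS : ∀ x, e x ∈ S := fun x => (S.equivFin.symm x).2
  have hsurj : ∀ v ∈ S, ∃ x, e x = v := fun v hv => ⟨S.equivFin ⟨v, hv⟩, by simp [e]⟩
  have hcn : (G.comap e).cliqueNum ≤ a := by
    obtain ⟨Q, hQc⟩ := (G.comap e).exists_isNClique_cliqueNum
    rw [← hQc.card_eq, ← Finset.card_map e]
    refine hQ _ ?_ ?_
    · intro v hv
      obtain ⟨x, _, rfl⟩ := Finset.mem_map.1 hv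
      exact heS x
    · intro u hu v hv huv
      obtain ⟨x, hx, rfl⟩ := Finset.mem_map.1 (Finset.mem_coe.1 hu)
      obtain ⟨y, hy, rfl⟩ := Finset.mem_map.1 (Finset.mem_coe.1 hv)
      exact hQc.isClique hx hy (fun h => huv (by rw [h]))
  have hfr : IsInducedFree (G.comap e) (doubleStarGraph s) := by
    rw [inducedFree_iff] at hfree ⊢
    exact ⟨fun φ => hfree.false (φ.trans (SimpleGraph.Embedding.comap e G))⟩
  obtain ⟨c, hc⟩ := hind (Fin S.card) (G.comap e) hfr (hcn.trans_lt ha)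
  refine Col.mono (n := (G.comap e).cliqueNum ^ d) ?_ (Finset.Subset.refl _)
    (Nat.pow_le_pow_left hcn d)
  refine ⟨fun v => if h : v ∈ S then (c (S.equivFin ⟨v, h⟩) : ℕ) else 0, ?_, ?_⟩
  · intro v hv
    simp only [hv, dif_pos]
    exact (c _).2
  · intro T hTS hne hmono
    have hce : ∀ x, (if h : e x ∈ S then (c (S.equivFin ⟨e x, h⟩) : ℕ) else 0) = c x := by
      intro x
      rw [dif_pos (heS x)]
      congr 2
      exact S.equivFin.apply_symm_apply x
    obtain ⟨t, ht⟩ := hne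
    obtain ⟨x0, rfl⟩ := hsurj t (hTS ht)
    have hcol : ∀ x, e x ∈ T → c x = c x0 := by
      intro x hx
      have := hmono _ hx _ ht
      simp only [hce] at this
      exact Fin.ext this
    let H : ((G.comap e).induce {v | c v = c x0}).Subgraph :=
      (⊤ : ((G.comap e).induce {v | c v = c x0}).Subgraph).induce {x | e x.1 ∈ T}
    obtain ⟨x, hx, hxd⟩ := hc (c x0) H ⟨⟨x0, rfl⟩, ht⟩
    refine ⟨e x.1, hx, le_trans ?_ hxd⟩
    have hg : Function.Injective (fun y : {v | c v = c x0} => e y.1) :=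
      fun y z hyz => Subtype.ext (e.injective hyz)
    rw [← Set.ncard_image_of_injective _ hg, ← Set.ncard_coe_finset]
    refine Set.ncard_le_ncard ?_ (Set.toFinite _)
    intro v hv
    rw [Finset.mem_coe, Finset.mem_filter] at hv
    obtain ⟨y, rfl⟩ := hsurj v (hTS hv.1)
    refine ⟨⟨y, hcol y hv.1⟩, ?_, rfl⟩
    change H.Adj x _
    simp only [H, SimpleGraph.Subgraph.induce_adj, SimpleGraph.Subgraph.top_adj]
    exact ⟨hx, hv.1, hv.2⟩

end Bridge

/-- If every `H_s`-free graph with smaller clique number is `(ω'^d, D)`-colourable, then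
(with `m = (s+1) ω^s`, `ω ≥ 200` and `ω³ > ω + s/7`) the union of the sets `M_I` over all
`m`-large `I` is `(K, D)`-colourable, where `K = (ω−1)^d + ω^{s²+4s+2} + ω^{s+3} + 1`. -/
theorem template_large_colourable {V : Type*} [Fintype V] (G : SimpleGraph V) (s : ℕ)
    (hs : 1 ≤ s) (hfree : IsInducedFree G (doubleStarGraph s))
    (hω : 200 ≤ G.cliqueNum) (hω3 : 7 * G.cliqueNum ^ 3 > 7 * G.cliqueNum + s)
    (L0 : Set V) (k : ℕ) (L : Fin k → Set V) (hT : IsOptimalTemplate G s L0 L)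
    (d D : ℕ) (hd : 1 ≤ d)
    (hind : ∀ (W : Type) [Fintype W], ∀ G' : SimpleGraph W,
      IsInducedFree G' (doubleStarGraph s) → G'.cliqueNum < G.cliqueNum →
      KDColorable G' (G'.cliqueNum ^ d) D) :
    KDColorable
      (G.induce {v | ∃ I : Set (Fin k),
        (s+1) * G.cliqueNum ^ s < (templatePart G s L0 L I).ncard ∧
        v ∈ templatePart G s L0 L I})
      ((G.cliqueNum - 1) ^ d + G.cliqueNum ^ (s*s + 4*s + 2) + G.cliqueNum ^ (s+3) + 1)
      D := by
  classical
  obtain ⟨⟨-, -, -, -, hcard, hnon⟩, -⟩ := hT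
  have hfilt : ∀ (A : Set V) (v : V),
      ((A.toFinset).filter (fun u => ¬ G.Adj v u)).card = ({u ∈ A | ¬ G.Adj v u}).ncard := by
    intro A v
    rw [← Set.ncard_coe_finset]
    congr 1
    ext u
    simp
  have hset : Setup G s G.cliqueNum k (fun i => (L i).toFinset)
      (fun I => (templatePart G s L0 L (I : Set (Fin k))).toFinset) := by
    refine ⟨hs, hfree, hω, hω3, fun Q hQ => hQ.card_le_cliqueNum, ?_, ?_, ?_, ?_, ?_, ?_⟩
    · intro i
      rw [← Set.ncard_eq_toFinset_card']
      exact (hcard i).1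
    · intro i j hij v hv
      rw [hfilt]
      exact hnon i j hij v (Set.mem_toFinset.1 hv)
    · intro I v hv i hi
      rw [hfilt]
      obtain ⟨_, hp, hI⟩ := Set.mem_toFinset.1 hv
      obtain ⟨u, hu, huv⟩ := (hI i).2 hi
      exact (hp.2 i).resolve_left fun hno => hno u hu huv
    · intro I v hv i hi u hu huv
      obtain ⟨_, hp, hI⟩ := Set.mem_toFinset.1 hv
      exact hi ((hI i).1 ⟨u, Set.mem_toFinset.1 hu, huv⟩)
    · intro I v hv
      obtain ⟨_, hp, hI⟩ := Set.mem_toFinset.1 hv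
      obtain ⟨i₁, i₂, hne, h1, h2⟩ := hp.1
      refine ⟨i₁, i₂, hne, fun h => ?_, fun h => ?_⟩
      · obtain ⟨u, hu, huv⟩ := (hI i₁).2 h
        exact h1 u hu huv
      · obtain ⟨u, hu, huv⟩ := (hI i₂).2 h
        exact h2 u hu huv
    · intro I v hv
      obtain ⟨hn, hp, hI⟩ := Set.mem_toFinset.1 hv
      obtain ⟨i, hi⟩ := hn.2
      exact ⟨i, (hI i).1 hi⟩
  have hcore := hset.core D d hd (fun S a ha hQ =>
    ind_to_col G s G.cliqueNum d D hfree hind S a ha hQ)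
  refine hcore.toKD ?_
  rintro v ⟨I, hI, hv⟩
  refine Finset.mem_biUnion.2 ⟨I.toFinset, Finset.mem_filter.2 ⟨Finset.mem_univ _, ?_⟩, ?_⟩
  · rw [← Set.ncard_eq_toFinset_card', Set.coe_toFinset]
    exact hI
  · rw [Set.coe_toFinset, Set.mem_toFinset]
    exact hv
end
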